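/- Let d ≥ 2 and d/2 < p < ∞, and let V ∈ L^p(B^d) be radial and real-valued (so that V ∈ V_d), with Born approximation W. Then for every M > 0 such that ‖V‖_{L^p(B^d)} < (|S^{d-1}|^{1/p}/4) · ((p - d/2)/(p - 1)) · M, one has ∫_{B^d} |W(x)| |x|^{M-(d-2)} dx < M · |S^{d-1}|. -/

import Mathlib

open MeasureTheory Real Set
open scoped ENNReal NNReal

noncomputable section

/-- Euclidean space `ℝ^d`. -/
abbrev Edim (d : ℕ) := EuclideanSpace ℝ (Fin d)

/-- The open unit ball `B^d ⊂ ℝ^d`. -/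
def unitBall (d : ℕ) : Set (Edim d) := Metric.ball 0 1

/-- `|S^{d-1}|`, the `(d-1)`-dimensional measure of the unit sphere, i.e. `d · ω_d`. -/
def sphereArea (d : ℕ) : ℝ := d * (volume (Metric.ball (0 : Edim d) 1)).toReal

/-- The annulus `U_b = {x : b < |x| < 1}`. -/
def annulusU (d : ℕ) (b : ℝ) : Set (Edim d) := {x : Edim d | b < ‖x‖ ∧ ‖x‖ < 1}

/-- The `𝒱_d` norm:
`‖V‖_{𝒱_d} = sup_{j ∈ ℕ} ∫_{2^{-(j+1)} < |x| < 2^{-j}} |V(x)| |x|^{2-d} dx`, as an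
extended real number. -/
def VdNorm (d : ℕ) (V : Edim d → ℝ) : ℝ≥0∞ :=
  ⨆ j : ℕ, ∫⁻ x in {x : Edim d | (2:ℝ) ^ (-(j:ℝ) - 1) < ‖x‖ ∧ ‖x‖ < (2:ℝ) ^ (-(j:ℝ))},
    ENNReal.ofReal (|V x| * ‖x‖ ^ ((2:ℝ) - (d:ℝ)))

/-- The constant `β_V = (2/|S^{d-1}|) · max( √(6 |S^{d-1}| ‖V‖), 3e ‖V‖ )`. -/
def betaV (d : ℕ) (V : Edim d → ℝ) : ℝ :=
  (2 / sphereArea d) *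
    max (Real.sqrt (6 * sphereArea d * (VdNorm d V).toReal))
      (3 * Real.exp 1 * (VdNorm d V).toReal)

/-- The constant `k_V = β_V - (d-2)/2`. -/
def kV (d : ℕ) (V : Edim d → ℝ) : ℝ := betaV d V - ((d:ℝ) - 2) / 2

/-- `b`, with derivative `b'` on `(0,1]`, is a solution of the radial equation of degree `k`:
`b ∈ C¹((0,1])`, `r ↦ r^{d-1} b'(r)` is locally absolutely continuous on `(0,1]` (encoded
via a locally integrable density `g` together with the fundamental theorem of calculus), and
`-(r^{d-1}b'(r))'/r^{d-1} + (k(k+d-2)/r² + q(r)) b(r) = 0` for a.e. `r ∈ (0,1)`. -/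
def IsRadialSolution (d : ℕ) (q : ℝ → ℝ) (k : ℕ) (b b' : ℝ → ℝ) : Prop :=
  (∀ r ∈ Set.Ioc (0:ℝ) 1, HasDerivWithinAt b (b' r) (Set.Ioc 0 1) r) ∧
  ContinuousOn b' (Set.Ioc 0 1) ∧
  ∃ g : ℝ → ℝ, MeasureTheory.LocallyIntegrableOn g (Set.Ioc 0 1) ∧
    (∀ r₁ ∈ Set.Ioc (0:ℝ) 1, ∀ r₂ ∈ Set.Ioc (0:ℝ) 1, r₁ ≤ r₂ →
      r₂ ^ ((d:ℝ) - 1) * b' r₂ - r₁ ^ ((d:ℝ) - 1) * b' r₁ = ∫ t in r₁..r₂, g t) ∧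
    (∀ᵐ r ∂(volume.restrict (Set.Ioo (0:ℝ) 1)),
      -(g r) / r ^ ((d:ℝ) - 1) + (((k:ℝ) * ((k:ℝ) + (d:ℝ) - 2)) / r ^ 2 + q r) * b r = 0)

/-- The normalized solution of the radial equation of degree `k` from Lemma 2.1:
`b(1) = 1` together with the weighted square integrability `∫₀¹ |b(r)|² r^{d-2} dr < ∞`. -/
def IsDtNSolution (d : ℕ) (q : ℝ → ℝ) (k : ℕ) (b b' : ℝ → ℝ) : Prop :=
  IsRadialSolution d q k b b' ∧ b 1 = 1 ∧
    (∫⁻ r in Set.Ioo (0:ℝ) 1, ENNReal.ofReal ((b r) ^ 2 * r ^ ((d:ℝ) - 2))) < ⊤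

/-- `lamk` is the generalized Dirichlet-to-Neumann eigenvalue `λ_k[V]` of the radial
potential with profile `q`: if there is a (necessarily unique) normalized solution `b_k` of
the radial equation of degree `k` which is square integrable for the weight `r^{d-2}`, then
`λ_k[V] = b_k'(1)`; otherwise `λ_k[V] = k`. -/
def IsGenEigenvalue (d : ℕ) (q : ℝ → ℝ) (k : ℕ) (lamk : ℝ) : Prop :=
  (∃ b b' : ℝ → ℝ, (IsDtNSolution d q k b b' ∧
      ∀ c c' : ℝ → ℝ, IsDtNSolution d q k c c' → Set.EqOn c b (Set.Ioc 0 1)) ∧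
      b' 1 = lamk) ∨
  (¬ (∃ b b' : ℝ → ℝ, IsDtNSolution d q k b b' ∧
      ∀ c c' : ℝ → ℝ, IsDtNSolution d q k c c' → Set.EqOn c b (Set.Ioc 0 1)) ∧
    lamk = k)

/-- `W` is a Born approximation of the radial potential `V = q(|·|) ∈ 𝒱_d`: `W` is a radial
measurable function such that, for some integer `k₀ > k_V`, `∫_{B^d} |W(x)||x|^{2k₀} dx < ∞`
and `(1/|S^{d-1}|) ∫_{B^d} W(x) |x|^{2k} dx = λ_k[V] - k` for every integer `k ≥ k₀`. -/
def IsBornApprox (d : ℕ) (q : ℝ → ℝ) (W : Edim d → ℝ) : Prop :=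
  Measurable W ∧ (∃ w : ℝ → ℝ, ∀ x, W x = w ‖x‖) ∧
  ∃ lam : ℕ → ℝ, (∀ k : ℕ, IsGenEigenvalue d q k (lam k)) ∧
    ∃ k₀ : ℕ, kV d (fun x : Edim d => q ‖x‖) < (k₀:ℝ) ∧
      (∫⁻ x in unitBall d, ENNReal.ofReal (|W x| * ‖x‖ ^ (2 * k₀))) < ⊤ ∧
      ∀ k : ℕ, k₀ ≤ k →
        (sphereArea d)⁻¹ * ∫ x in unitBall d, W x * ‖x‖ ^ (2 * k) = lam k - (k:ℝ)

/-- Integration by parts for a `C¹` function and an absolutely continuous one. -/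
lemma born_ibp {x y : ℝ} (hxy : x ≤ y) {f f' H h : ℝ → ℝ}
    (hf : ∀ t ∈ Icc x y, HasDerivWithinAt f (f' t) (Icc x y) t)
    (hf' : ContinuousOn f' (Icc x y)) (hh : IntervalIntegrable h volume x y)
    (hH : ∀ t ∈ Icc x y, H t - H x = ∫ s in x..t, h s) :
    f y * H y - f x * H x = ∫ t in x..y, (f' t * H t + f t * h t) := by
  have hu : uIcc x y = Icc x y := uIcc_of_le hxy
  have hfac : AbsolutelyContinuousOnInterval f x y := by
    obtain ⟨C, hC⟩ := isCompact_Icc.exists_bound_of_continuousOn hf'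
    have : LipschitzOnWith (Real.toNNReal C) f (Icc x y) := by
      refine Convex.lipschitzOnWith_of_nnnorm_hasDerivWithin_le (convex_Icc x y) hf ?_
      intro t ht
      rw [← NNReal.coe_le_coe, coe_nnnorm]
      exact (hC t ht).trans (Real.le_coe_toNNReal C)
    rw [← hu] at this
    exact this.absolutelyContinuousOnInterval
  set G : ℝ → ℝ := fun t => H x + ∫ s in x..t, h s with hG
  have hGac : AbsolutelyContinuousOnInterval G x y := by
    have h1 : AbsolutelyContinuousOnInterval (fun _ : ℝ => H x) x y :=
      (LipschitzWith.const (H x)).lipschitzOnWith.absolutelyContinuousOnInterval (K := 0)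
    exact h1.fun_add (hh.absolutelyContinuousOnInterval_intervalIntegral (c := x) (by simp))
  have hGH : ∀ t ∈ Icc x y, H t = G t := by
    intro t ht
    have := hH t ht
    simp only [hG]; linarith
  have key := hfac.integral_deriv_mul_eq_sub hGac
  rw [hGH y (right_mem_Icc.2 hxy), hGH x (left_mem_Icc.2 hxy), ← key]
  apply intervalIntegral.integral_congr_ae
  have hne : ∀ᵐ t : ℝ, t ≠ y := by
    simp [ae_iff, measure_singleton]
  filter_upwards [hh.ae_hasDerivAt_integral, hne] with t ht hty htm
  rw [uIoc_of_le hxy] at htm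
  have htI : t ∈ Icc x y := Ioc_subset_Icc_self htm
  have hd : HasDerivAt f (f' t) t :=
    (hf t htI).hasDerivAt (Icc_mem_nhds htm.1 (lt_of_le_of_ne htm.2 hty))
  have hGd : HasDerivAt G (h t) t := by
    have := ht (by rwa [hu]) x (by simp)
    exact this.const_add (H x)
  rw [hd.deriv, hGd.deriv, hGH t htI]

/-- The sequence `f` is (formally) the sequence of moments of a measure of total variation
at most `a` with respect to the weight `ρ ^ M`. -/
def BornNorm (M : ℝ) (f : ℕ → ℝ) (a : ℝ) : Prop :=
  ∀ (S : Finset ℕ) (c : ℕ → ℝ) (B : ℝ), (∀ n ∈ S, M < (n:ℝ)) →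
    (∀ ρ ∈ Ioc (0:ℝ) 1, |∑ n ∈ S, c n * ρ ^ n| ≤ B * ρ ^ M) → |∑ n ∈ S, c n * f n| ≤ a * B

/-- The Picard map of the Riccati equation. -/
def bornPhi (q : ℝ → ℝ) (N : ℕ) (F : ℝ → ℝ) (r : ℝ) : ℝ :=
  (r ^ N)⁻¹ * ∫ s in (0:ℝ)..r, s ^ N * (s * q s - F s ^ 2 / s)

/-- Picard iterates. -/
def bornIter (q : ℝ → ℝ) (N : ℕ) : ℕ → ℝ → ℝ
  | 0 => fun _ => 0
  | m + 1 => bornPhi q N (bornIter q N m)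

lemma BornNorm.single {M : ℝ} {f : ℕ → ℝ} {a : ℝ} (h : BornNorm M f a) {n : ℕ}
    (hn : M < n) : |f n| ≤ a := by
  have := h {n} (fun _ => 1) 1 (by simpa using hn) (by
    intro ρ hρ
    have h0 : 0 < ρ := hρ.1
    simp only [Finset.sum_singleton, one_mul]
    rw [abs_of_nonneg (by positivity), ← Real.rpow_natCast]
    exact Real.rpow_le_rpow_of_exponent_ge hρ.1 hρ.2 hn.le)
  simpa using this

lemma born_pow_div_le {s : ℝ} (hs : s ∈ Ioc (0:ℝ) 1) {N : ℕ} (hN : 1 ≤ N) : s ^ N / s ≤ 1 := by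
  rw [div_le_one hs.1]
  calc s ^ N ≤ s ^ 1 := pow_le_pow_of_le_one hs.1.le hs.2 hN
    _ = s := pow_one s

lemma born_integrand_bound {q F : ℝ → ℝ} {N : ℕ} (hN : 1 ≤ N) {a s : ℝ}
    (hs : s ∈ Ioc (0:ℝ) 1) (hF : |F s| ≤ a) :
    ‖s ^ N * (s * q s - F s ^ 2 / s)‖ ≤ |s * q s| + a ^ 2 := by
  have h0 : 0 < s := hs.1
  have h1 : s ^ N ≤ 1 := pow_le_one₀ hs.1.le hs.2
  have h2 := born_pow_div_le hs hN
  have h3 : F s ^ 2 ≤ a ^ 2 := sq_le_sq' (by linarith [neg_abs_le (F s)]) ((le_abs_self _).trans hF)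
  have e : s ^ N * (s * q s - F s ^ 2 / s) = s ^ N * (s * q s) - (s ^ N / s) * F s ^ 2 := by ring
  rw [Real.norm_eq_abs, e]
  refine (abs_sub _ _).trans ?_
  rw [abs_mul (s ^ N), abs_mul (s ^ N / s), abs_of_nonneg (show 0 ≤ s ^ N by positivity),
    abs_of_nonneg (show 0 ≤ s ^ N / s by positivity), abs_of_nonneg (sq_nonneg (F s))]
  have := mul_le_mul_of_nonneg_right h1 (abs_nonneg (s * q s))
  have := mul_le_mul_of_nonneg_right h2 (sq_nonneg (F s))
  linarith

lemma born_integrand_integrable {q F : ℝ → ℝ} (hq : Measurable q)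
    (hI : IntegrableOn (fun s => s * q s) (Ioc 0 1))
    {N : ℕ} (hN : 1 ≤ N) {a : ℝ}
    (hFm : AEStronglyMeasurable F (volume.restrict (Ioc (0:ℝ) 1)))
    (hF : ∀ s ∈ Ioc (0:ℝ) 1, |F s| ≤ a) :
    IntegrableOn (fun s => s ^ N * (s * q s - F s ^ 2 / s)) (Ioc 0 1) := by
  have hb : IntegrableOn (fun s => |s * q s| + a ^ 2) (Ioc 0 1) := by
    refine Integrable.add hI.abs ?_
    exact integrable_const _
  refine Integrable.mono' hb ?_ ?_
  · have h1 : AEMeasurable F (volume.restrict (Ioc (0:ℝ) 1)) := hFm.aemeasurable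
    refine AEMeasurable.aestronglyMeasurable ?_
    exact (measurable_id.pow_const N).aemeasurable.mul
      ((measurable_id.mul hq).aemeasurable.sub ((h1.pow_const 2).div measurable_id.aemeasurable))
  · filter_upwards [ae_restrict_mem measurableSet_Ioc] with s hs
    exact born_integrand_bound hN hs (hF s hs)

lemma born_ii {f : ℝ → ℝ} (hf : IntegrableOn f (Ioc 0 1)) {x y : ℝ} (hx : x ∈ Icc (0:ℝ) 1)
    (hy : y ∈ Icc (0:ℝ) 1) : IntervalIntegrable f volume x y := by
  rw [intervalIntegrable_iff]
  refine hf.mono_set ?_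
  intro t ht
  rw [mem_uIoc] at ht
  rcases ht with ht | ht
  · exact ⟨lt_of_le_of_lt hx.1 ht.1, ht.2.trans hy.2⟩
  · exact ⟨lt_of_le_of_lt hy.1 ht.1, ht.2.trans hx.2⟩

lemma born_cont_of_int {φ : ℝ → ℝ} (hφ : IntegrableOn φ (Ioc 0 1)) (N : ℕ) :
    ContinuousOn (fun r => (r ^ N)⁻¹ * ∫ s in (0:ℝ)..r, φ s) (Ioc 0 1) := by
  refine ContinuousOn.mul ?_ ?_
  · refine ContinuousOn.inv₀ (by fun_prop) ?_
    intro r hr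
    exact pow_ne_zero _ hr.1.ne'
  · have h := intervalIntegral.continuousOn_primitive_interval' (μ := volume) (f := φ)
      (a := 0) (b₁ := 0) (b₂ := 1) (born_ii hφ (by simp) (by simp)) (by simp)
    refine h.mono ?_
    rw [uIcc_of_le zero_le_one]
    exact Ioc_subset_Icc_self

lemma born_int_pow {M r : ℝ} (hM : 0 < M) (hr : 0 < r) :
    IntervalIntegrable (fun s => (s / r) ^ M / s) volume 0 r ∧
    ∫ s in (0:ℝ)..r, (s / r) ^ M / s = 1 / M := by
  have hcong : ∀ s ∈ Ioc 0 r, (s / r) ^ M / s = (r ^ M)⁻¹ * s ^ (M - 1) := by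
    intro s hs
    rw [Real.div_rpow hs.1.le hr.le, Real.rpow_sub_one hs.1.ne']
    have := (Real.rpow_pos_of_pos hr M).ne'
    have := hs.1.ne'
    field_simp
  have hi : IntervalIntegrable (fun s => (r ^ M)⁻¹ * s ^ (M - 1)) volume 0 r :=
    (intervalIntegral.intervalIntegrable_rpow' (by linarith)).const_mul _
  constructor
  · refine hi.congr ?_
    rw [uIoc_of_le hr.le]
    intro s hs
    exact (hcong s hs).symm
  · have : ∫ s in (0:ℝ)..r, (s / r) ^ M / s = ∫ s in (0:ℝ)..r, (r ^ M)⁻¹ * s ^ (M - 1) := by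
      refine intervalIntegral.integral_congr_ae (Filter.Eventually.of_forall ?_)
      rw [uIoc_of_le hr.le]
      exact hcong
    rw [this, intervalIntegral.integral_const_mul, integral_rpow (Or.inl (by linarith))]
    have h0 := (Real.rpow_pos_of_pos hr M).ne'
    rw [sub_add_cancel, Real.zero_rpow hM.ne']
    field_simp
    ring

lemma bornPhi_eq {q F : ℝ → ℝ} {N : ℕ} {r : ℝ} :
    bornPhi q N F r = ∫ s in (0:ℝ)..r, (s / r) ^ N * (s * q s - F s ^ 2 / s) := by
  unfold bornPhi
  rw [← intervalIntegral.integral_const_mul]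
  congr 1
  ext s
  rw [div_pow]; ring

lemma born_norm_step {M : ℝ} (hM : 0 < M) {q : ℝ → ℝ} (hq : Measurable q)
    (hI : IntegrableOn (fun s => s * q s) (Ioc 0 1))
    (hQ : ∫ s in (0:ℝ)..1, |s * q s| ≤ M / 4) {F : ℕ → ℝ → ℝ}
    (hFm : ∀ n : ℕ, M < n → AEStronglyMeasurable (F n) (volume.restrict (Ioc (0:ℝ) 1)))
    (hF : ∀ s ∈ Ioc (0:ℝ) 1, BornNorm M (fun n => F n s) (M / 2)) {r : ℝ}
    (hr : r ∈ Ioc (0:ℝ) 1) :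
    BornNorm M (fun n => bornPhi q n (F n) r) (M / 2) := by
  intro S c B hS hB
  have hr0 : 0 < r := hr.1
  have hB0 : 0 ≤ B := by
    have := hB 1 (by simp)
    simp only [Real.one_rpow, mul_one] at this
    exact (abs_nonneg _).trans this
  have hint : ∀ n ∈ S, IntervalIntegrable
      (fun s => c n * ((s / r) ^ n * (s * q s - F n s ^ 2 / s))) volume 0 r := by
    intro n hn
    have hn1 : 1 ≤ n := by
      have h := hM.trans (hS n hn)
      exact_mod_cast h
    have h := born_ii (born_integrand_integrable hq hI hn1 (hFm n (hS n hn))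
      (fun s hs => (hF s hs).single (hS n hn))) (x := 0) (y := r) (by simp) ⟨hr.1.le, hr.2⟩
    refine (h.const_mul (c n * (r ^ n)⁻¹)).congr ?_
    intro s _
    simp only [div_pow]; ring
  have e : ∑ n ∈ S, c n * bornPhi q n (F n) r
      = ∫ s in (0:ℝ)..r, ∑ n ∈ S, c n * ((s / r) ^ n * (s * q s - F n s ^ 2 / s)) := by
    rw [intervalIntegral.integral_finsetSum hint]
    refine Finset.sum_congr rfl fun n _ => ?_
    rw [bornPhi_eq, intervalIntegral.integral_const_mul]
  simp only [e]
  have hqi : IntervalIntegrable (fun s => |s * q s|) volume 0 r :=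
    born_ii hI.abs (by simp) ⟨hr.1.le, hr.2⟩
  have hpi := born_int_pow hM hr0
  have hbi : IntervalIntegrable (fun s => B * |s * q s| + M / 2 * (M / 2) * B * ((s / r) ^ M / s))
      volume 0 r := (hqi.const_mul B).add (hpi.1.const_mul _)
  have hpt : ∀ s ∈ Ioc 0 r, ‖∑ n ∈ S, c n * ((s / r) ^ n * (s * q s - F n s ^ 2 / s))‖
      ≤ B * |s * q s| + M / 2 * (M / 2) * B * ((s / r) ^ M / s) := by
    intro s hs
    have hs0 : 0 < s := hs.1
    have hs1 : s ∈ Ioc (0:ℝ) 1 := ⟨hs.1, hs.2.trans hr.2⟩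
    have ht : s / r ∈ Ioc (0:ℝ) 1 := ⟨by positivity, (div_le_one hr0).2 hs.2⟩
    set t := s / r with htdef
    have ht0 : 0 < t := ht.1
    have h1 : |∑ n ∈ S, c n * t ^ n| ≤ B := by
      refine (hB t ht).trans ?_
      have : t ^ M ≤ 1 := Real.rpow_le_one ht.1.le ht.2 hM.le
      nlinarith
    have h2 : |∑ n ∈ S, (c n * t ^ n * F n s) * F n s| ≤ M / 2 * (M / 2 * (B * t ^ M)) := by
      refine hF s hs1 S (fun n => c n * t ^ n * F n s) _ hS ?_
      intro ρ hρ
      have hρ0 : 0 < ρ := hρ.1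
      have := hF s hs1 S (fun n => c n * (t * ρ) ^ n) (B * (t * ρ) ^ M) hS (by
        intro σ hσ
        have hσ0 : 0 < σ := hσ.1
        have h3 := hB (t * ρ * σ) ⟨by positivity, by
          have := mul_le_one₀ ht.2 hρ.1.le hρ.2
          exact mul_le_one₀ this hσ.1.le hσ.2⟩
        rw [Real.mul_rpow (by positivity) hσ.1.le] at h3
        calc _ = |∑ n ∈ S, c n * (t * ρ * σ) ^ n| := by
              congr 1
              refine Finset.sum_congr rfl fun n _ => ?_
              rw [mul_pow (t * ρ) σ n]; ring
          _ ≤ _ := h3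
          _ = _ := by ring)
      rw [Real.mul_rpow ht.1.le hρ.1.le] at this
      calc _ = |∑ n ∈ S, c n * (t * ρ) ^ n * F n s| := by
            congr 1
            refine Finset.sum_congr rfl fun n _ => ?_
            rw [mul_pow t ρ n]; ring
        _ ≤ _ := this
        _ = _ := by ring
    have e2 : ∑ n ∈ S, c n * (t ^ n * (s * q s - F n s ^ 2 / s))
        = (∑ n ∈ S, c n * t ^ n) * (s * q s) - (∑ n ∈ S, (c n * t ^ n * F n s) * F n s) / s := by
      rw [Finset.sum_mul, Finset.sum_div, ← Finset.sum_sub_distrib]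
      refine Finset.sum_congr rfl fun n _ => ?_
      ring
    rw [e2, Real.norm_eq_abs]
    refine (abs_sub _ _).trans ?_
    rw [abs_mul, abs_div, abs_of_pos hs0]
    have h4 := mul_le_mul_of_nonneg_right h1 (abs_nonneg (s * q s))
    have h5 := div_le_div_of_nonneg_right h2 hs0.le
    have h6 : M / 2 * (M / 2 * (B * t ^ M)) / s = M / 2 * (M / 2) * B * (t ^ M / s) := by ring
    linarith
  have hle := intervalIntegral.norm_integral_le_of_norm_le hr0.le
    (Filter.Eventually.of_forall hpt) hbi
  rw [Real.norm_eq_abs] at hle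
  refine hle.trans ?_
  rw [intervalIntegral.integral_add (hqi.const_mul B) (hpi.1.const_mul _),
    intervalIntegral.integral_const_mul, intervalIntegral.integral_const_mul, hpi.2]
  have hmono : ∫ s in (0:ℝ)..r, |s * q s| ≤ ∫ s in (0:ℝ)..1, |s * q s| := by
    refine intervalIntegral.integral_mono_interval le_rfl hr.1.le hr.2
      (Filter.Eventually.of_forall fun s => abs_nonneg _) (born_ii hI.abs (by simp) (by simp))
  have h7 := mul_le_mul_of_nonneg_left (hmono.trans hQ) hB0
  have h8 : M / 2 * (M / 2) * B * (1 / M) = M / 4 * B := by field_simp; ring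
  linarith

lemma born_iter_good {M : ℝ} (hM : 0 < M) {q : ℝ → ℝ} (hq : Measurable q)
    (hI : IntegrableOn (fun s => s * q s) (Ioc 0 1))
    (hQ : ∫ s in (0:ℝ)..1, |s * q s| ≤ M / 4) (m : ℕ) :
    (∀ n : ℕ, M < n → ContinuousOn (bornIter q n m) (Ioc 0 1)) ∧
    ∀ r ∈ Ioc (0:ℝ) 1, BornNorm M (fun n => bornIter q n m r) (M / 2) := by
  induction m with
  | zero =>
    refine ⟨fun n _ => continuousOn_const, fun r _ S c B _ hB => ?_⟩
    have := hB 1 (by simp)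
    simp only [Real.one_rpow, mul_one] at this
    have hB0 : 0 ≤ B := (abs_nonneg _).trans this
    simp only [bornIter, mul_zero, Finset.sum_const_zero, abs_zero]
    positivity
  | succ m ih =>
    have hm : ∀ n : ℕ, M < n →
        AEStronglyMeasurable (bornIter q n m) (volume.restrict (Ioc (0:ℝ) 1)) :=
      fun n hn => (ih.1 n hn).aestronglyMeasurable measurableSet_Ioc
    refine ⟨fun n hn => ?_, fun r hr => born_norm_step hM hq hI hQ hm ih.2 hr⟩
    have hn1 : 1 ≤ n := by
      have h := hM.trans hn
      exact_mod_cast h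
    exact born_cont_of_int (born_integrand_integrable hq hI hn1 (hm n hn)
      (fun s hs => (ih.2 s hs).single hn)) n

lemma born_contract {M : ℝ} (hM : 0 < M) {q : ℝ → ℝ} (hq : Measurable q)
    (hI : IntegrableOn (fun s => s * q s) (Ioc 0 1)) {n : ℕ} (hn : M < n) {F G : ℝ → ℝ}
    (hFm : AEStronglyMeasurable F (volume.restrict (Ioc (0:ℝ) 1)))
    (hGm : AEStronglyMeasurable G (volume.restrict (Ioc (0:ℝ) 1)))
    (hF : ∀ s ∈ Ioc (0:ℝ) 1, |F s| ≤ M / 2) (hG : ∀ s ∈ Ioc (0:ℝ) 1, |G s| ≤ M / 2)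
    {δ : ℝ} (hδ : ∀ s ∈ Ioc (0:ℝ) 1, |F s - G s| ≤ δ) {r : ℝ} (hr : r ∈ Ioc (0:ℝ) 1) :
    |bornPhi q n F r - bornPhi q n G r| ≤ M / n * δ := by
  have hn0 : (0:ℝ) < n := hM.trans hn
  have hn1 : 1 ≤ n := by exact_mod_cast hn0
  have hi : ∀ {F : ℝ → ℝ}, AEStronglyMeasurable F (volume.restrict (Ioc (0:ℝ) 1)) →
      (∀ s ∈ Ioc (0:ℝ) 1, |F s| ≤ M / 2) → IntervalIntegrable
      (fun s => (s / r) ^ n * (s * q s - F s ^ 2 / s)) volume 0 r := by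
    intro F hFm hF
    have h := born_ii (born_integrand_integrable hq hI hn1 hFm hF) (x := 0) (y := r)
      (by simp) ⟨hr.1.le, hr.2⟩
    refine (h.const_mul ((r ^ n)⁻¹)).congr ?_
    intro s _
    simp only [div_pow]; ring
  rw [bornPhi_eq, bornPhi_eq, ← intervalIntegral.integral_sub (hi hFm hF) (hi hGm hG)]
  have hpi := born_int_pow hn0 hr.1
  have hle := intervalIntegral.norm_integral_le_of_norm_le (a := 0) (b := r) (μ := volume)
    (f := fun s => (s / r) ^ n * (s * q s - F s ^ 2 / s) - (s / r) ^ n * (s * q s - G s ^ 2 / s))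
    (g := fun s => M * δ * ((s / r) ^ (n:ℝ) / s)) hr.1.le (Filter.Eventually.of_forall ?_)
    (hpi.1.const_mul _)
  · rw [Real.norm_eq_abs] at hle
    refine hle.trans ?_
    rw [intervalIntegral.integral_const_mul, hpi.2]
    apply le_of_eq; ring
  · intro s hs
    have hs0 : 0 < s := hs.1
    have hr0 : 0 < r := hr.1
    have hs1 : s ∈ Ioc (0:ℝ) 1 := ⟨hs.1, hs.2.trans hr.2⟩
    have e : (s / r) ^ n * (s * q s - F s ^ 2 / s) - (s / r) ^ n * (s * q s - G s ^ 2 / s)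
        = -((F s + G s) * (F s - G s)) * ((s / r) ^ n / s) := by ring
    rw [e, Real.norm_eq_abs, abs_mul, abs_neg, abs_mul, Real.rpow_natCast,
      abs_of_nonneg (show 0 ≤ (s / r) ^ n / s by positivity)]
    have h1 : |F s + G s| ≤ M := by
      have := abs_add_le (F s) (G s)
      linarith [hF s hs1, hG s hs1]
    have h2 := mul_le_mul h1 (hδ s hs1) (abs_nonneg _) hM.le
    exact mul_le_mul_of_nonneg_right h2 (by positivity)

/-- Existence of solutions of the Riccati equation, with the moment bound. -/
lemma born_riccati {M : ℝ} (hM : 0 < M) {q : ℝ → ℝ} (hq : Measurable q)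
    (hI : IntegrableOn (fun s => s * q s) (Ioc 0 1))
    (hQ : ∫ s in (0:ℝ)..1, |s * q s| ≤ M / 4) :
    ∃ F : ℕ → ℝ → ℝ, (∀ r ∈ Ioc (0:ℝ) 1, BornNorm M (fun n => F n r) (M / 2)) ∧
      ∀ n : ℕ, M < n → ContinuousOn (F n) (Ioc 0 1) ∧
        ∀ r ∈ Ioc (0:ℝ) 1, r ^ n * F n r = ∫ s in (0:ℝ)..r, s ^ n * (s * q s - F n s ^ 2 / s) := by
  have good := born_iter_good hM hq hI hQ
  have hm : ∀ m (n : ℕ), M < n →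
        AEStronglyMeasurable (bornIter q n m) (volume.restrict (Ioc (0:ℝ) 1)) :=
      fun m n hn => ((good m).1 n hn).aestronglyMeasurable measurableSet_Ioc
  have hb : ∀ m (n : ℕ), M < n → ∀ s ∈ Ioc (0:ℝ) 1, |bornIter q n m s| ≤ M / 2 :=
    fun m n hn s hs => ((good m).2 s hs).single hn
  have hgeo : ∀ (n : ℕ), M < n → ∀ m, ∀ s ∈ Ioc (0:ℝ) 1,
      |bornIter q n m s - bornIter q n (m + 1) s| ≤ M / 2 * (M / n) ^ m := by
    intro n hn m
    induction m with
    | zero =>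
      intro s hs
      simpa [bornIter] using hb 1 n hn s hs
    | succ m ih =>
      intro s hs
      have := born_contract hM hq hI hn (hm m n hn) (hm (m + 1) n hn) (hb m n hn)
        (hb (m + 1) n hn) ih hs
      calc _ ≤ _ := this
        _ = _ := by ring
  have hlim : ∀ (n : ℕ), M < n → ∀ s ∈ Ioc (0:ℝ) 1, ∃ y,
      Filter.Tendsto (fun m => bornIter q n m s) Filter.atTop (nhds y) := by
    intro n hn s hs
    refine cauchySeq_tendsto_of_complete (cauchySeq_of_le_geometric (M / n) (M / 2) ?_ ?_)
    · rw [div_lt_one (hM.trans hn)]; exact hn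
    · intro m
      rw [Real.dist_eq]
      exact hgeo n hn m s hs
  set F : ℕ → ℝ → ℝ := fun n s => Filter.atTop.limUnder (fun m => bornIter q n m s) with hFdef
  have hF : ∀ (n : ℕ), M < n → ∀ s ∈ Ioc (0:ℝ) 1,
      Filter.Tendsto (fun m => bornIter q n m s) Filter.atTop (nhds (F n s)) :=
    fun n hn s hs => tendsto_nhds_limUnder (hlim n hn s hs)
  have hFN : ∀ r ∈ Ioc (0:ℝ) 1, BornNorm M (fun n => F n r) (M / 2) := by
    intro r hr S c B hS hB
    have ht : Filter.Tendsto (fun m => |∑ n ∈ S, c n * bornIter q n m r|) Filter.atTop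
        (nhds |∑ n ∈ S, c n * F n r|) := by
      refine Filter.Tendsto.abs (tendsto_finsetSum _ fun n hn => ?_)
      exact (hF n (hS n hn) r hr).const_mul _
    exact le_of_tendsto' ht fun m => (good m).2 r hr S c B hS hB
  refine ⟨F, hFN, fun n hn => ?_⟩
  have hn1 : 1 ≤ n := by
    have h := hM.trans hn
    exact_mod_cast h
  have hFm : AEStronglyMeasurable (F n) (volume.restrict (Ioc (0:ℝ) 1)) := by
    refine aestronglyMeasurable_of_tendsto_ae Filter.atTop (fun m => hm m n hn) ?_
    filter_upwards [ae_restrict_mem measurableSet_Ioc] with s hs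
    exact hF n hn s hs
  have hFb : ∀ s ∈ Ioc (0:ℝ) 1, |F n s| ≤ M / 2 := fun s hs => (hFN s hs).single hn
  have hfix : ∀ r ∈ Ioc (0:ℝ) 1, F n r = bornPhi q n (F n) r := by
    intro r hr
    have h1 : Filter.Tendsto (fun m => bornIter q n (m + 1) r) Filter.atTop (nhds (F n r)) :=
      (hF n hn r hr).comp (Filter.tendsto_add_atTop_nat 1)
    refine tendsto_nhds_unique h1 ?_
    have h2 : Filter.Tendsto (fun m => ∫ s in (0:ℝ)..r, s ^ n * (s * q s - bornIter q n m s ^ 2 / s))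
        Filter.atTop (nhds (∫ s in (0:ℝ)..r, s ^ n * (s * q s - F n s ^ 2 / s))) := by
      have hsub : ∀ s ∈ uIoc 0 r, s ∈ Ioc (0:ℝ) 1 := by
        intro s hs
        rw [uIoc_of_le hr.1.le] at hs
        exact ⟨hs.1, hs.2.trans hr.2⟩
      refine intervalIntegral.tendsto_integral_filter_of_dominated_convergence
        (fun s => |s * q s| + (M / 2) ^ 2) ?_ ?_ ?_ ?_
      · refine Filter.Eventually.of_forall fun m => ?_
        have := (born_integrand_integrable hq hI hn1 (hm m n hn) (hb m n hn)).aestronglyMeasurable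
        refine this.mono_measure (Measure.restrict_mono (fun s hs => hsub s hs) le_rfl)
      · refine Filter.Eventually.of_forall fun m => Filter.Eventually.of_forall fun s hs => ?_
        exact born_integrand_bound hn1 (hsub s hs) (hb m n hn s (hsub s hs))
      · exact (born_ii hI.abs (by simp) ⟨hr.1.le, hr.2⟩).add intervalIntegrable_const
      · refine Filter.Eventually.of_forall fun s hs => ?_
        exact ((((hF n hn s (hsub s hs)).pow 2).div_const s).const_sub _).const_mul _
    exact h2.const_mul _
  have hint := born_integrand_integrable hq hI hn1 hFm hFb
  constructor
  · exact (born_cont_of_int hint n).congr fun r hr => hfix r hr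
  · intro r hr
    have hr0 : r ^ n ≠ 0 := pow_ne_zero _ hr.1.ne'
    rw [hfix r hr, bornPhi, mul_inv_cancel_left₀ hr0]

lemma born_rpow_d (D : ℕ) (r : ℝ) : r ^ (((D + 2 : ℕ) : ℝ) - 1) = r ^ (D + 1) := by
  rw [← Real.rpow_natCast]; congr 1; push_cast; ring

lemma born_rpow_d2 (D : ℕ) (r : ℝ) : r ^ (((D + 2 : ℕ) : ℝ) - 2) = r ^ D := by
  rw [← Real.rpow_natCast]; congr 1; push_cast; ring

/-- The solution attached to a Riccati solution. -/
def bornSol (k : ℕ) (F : ℝ → ℝ) (r : ℝ) : ℝ := Real.exp (∫ s in (1:ℝ)..r, ((k:ℝ) + F s) / s)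

lemma bornSol_pos (k : ℕ) (F : ℝ → ℝ) (r : ℝ) : 0 < bornSol k F r := Real.exp_pos _

lemma bornSol_one (k : ℕ) (F : ℝ → ℝ) : bornSol k F 1 = 1 := by simp [bornSol]

lemma bornSol_deriv {k : ℕ} {F : ℝ → ℝ} (hF : ContinuousOn F (Ioi 0)) {r : ℝ} (hr : 0 < r) :
    HasDerivAt (bornSol k F) (bornSol k F r * ((k + F r) / r)) r := by
  have hc : ContinuousOn (fun s => ((k:ℝ) + F s) / s) (Ioi 0) :=
    (continuousOn_const.add hF).div continuousOn_id fun s hs => (ne_of_gt hs)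
  have hsub : uIcc 1 r ⊆ Ioi (0:ℝ) := by
    intro s hs
    rcases mem_uIcc.1 hs with h | h
    · exact lt_of_lt_of_le one_pos h.1
    · exact lt_of_lt_of_le hr h.1
  have hd : HasDerivAt (fun r => ∫ s in (1:ℝ)..r, ((k:ℝ) + F s) / s) ((k + F r) / r) r := by
    refine intervalIntegral.integral_hasDerivAt_right ((hc.mono hsub).intervalIntegrable) ?_ ?_
    · exact hc.stronglyMeasurableAtFilter isOpen_Ioi r hr
    · exact hc.continuousAt (Ioi_mem_nhds hr)
  exact hd.exp

lemma bornSol_le {k : ℕ} {F : ℝ → ℝ} (hF : ContinuousOn F (Ioi 0)) {a : ℝ}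
    (hFa : ∀ r ∈ Ioc (0:ℝ) 1, |F r| ≤ a) (hk : a + 1 ≤ k) {r : ℝ} (hr : r ∈ Ioc (0:ℝ) 1) :
    bornSol k F r ≤ r := by
  have hd : ∀ s : ℝ, 0 < s → HasDerivAt (fun s => bornSol k F s / s)
      (bornSol k F s * ((k + F s) - 1) / s ^ 2) s := by
    intro s hs
    have hne : s ≠ 0 := hs.ne'
    convert! (bornSol_deriv (k := k) hF hs).div (hasDerivAt_id s) hne using 1
    simp only [id]
    field_simp
  have hmono : MonotoneOn (fun s => bornSol k F s / s) (Ioc 0 1) := by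
    refine monotoneOn_of_hasDerivWithinAt_nonneg (convex_Ioc 0 1)
      (fun s hs => (hd s hs.1).continuousAt.continuousWithinAt)
      (f' := fun s => bornSol k F s * ((k + F s) - 1) / s ^ 2) ?_ ?_
    · intro s hs
      rw [interior_Ioc] at hs
      exact (hd s hs.1).hasDerivWithinAt
    · intro s hs
      rw [interior_Ioc] at hs
      have h1 := neg_abs_le (F s)
      have h2 := hFa s (Ioo_subset_Ioc_self hs)
      have h3 := bornSol_pos k F s
      have h4 : 0 ≤ (k + F s) - 1 := by linarith
      positivity
  have := hmono hr (right_mem_Ioc.2 one_pos) hr.2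
  simp only [bornSol_one, div_one] at this
  rwa [div_le_one hr.1] at this

lemma bornSol_isDtN {D k N : ℕ} (hN : N = 2 * k + D) {q F : ℝ → ℝ} (hq : Measurable q)
    (hI : IntegrableOn (fun s => s * q s) (Ioc 0 1)) (hF : ContinuousOn F (Ioi 0)) {a : ℝ}
    (hFa : ∀ r ∈ Ioc (0:ℝ) 1, |F r| ≤ a) (hk : a + 1 ≤ k)
    (hR : ∀ r ∈ Ioc (0:ℝ) 1, r ^ N * F r = ∫ s in (0:ℝ)..r, s ^ N * (s * q s - F s ^ 2 / s)) :
    IsDtNSolution (D + 2) q k (bornSol k F) (fun r => bornSol k F r * ((k + F r) / r)) := by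
  have ha : 0 ≤ a := (abs_nonneg _).trans (hFa 1 (by simp))
  have hk1 : (1:ℝ) ≤ k := by linarith
  have hk1' : 1 ≤ k := by exact_mod_cast hk1
  have hN1 : 1 ≤ N := by omega
  have hbc : ContinuousOn (bornSol k F) (Ioi 0) :=
    fun r hr => (bornSol_deriv (k := k) hF hr).continuousAt.continuousWithinAt
  have hsubI : Ioc (0:ℝ) 1 ⊆ Ioi 0 := fun s hs => hs.1
  have hhint : IntegrableOn (fun s => s ^ N * (s * q s - F s ^ 2 / s)) (Ioc 0 1) :=
    born_integrand_integrable hq hI hN1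
      ((hF.mono hsubI).aestronglyMeasurable measurableSet_Ioc) hFa
  refine ⟨⟨?_, ?_, ?_⟩, bornSol_one k F, ?_⟩
  · intro r hr
    exact (bornSol_deriv hF hr.1).hasDerivWithinAt
  · refine ContinuousOn.mono ?_ hsubI
    exact hbc.mul ((continuousOn_const.add hF).div continuousOn_id fun s hs => (ne_of_gt hs))
  · refine ⟨fun r => bornSol k F r * r ^ D * (r * q r) +
      bornSol k F r * r ^ D * (k * (k + D) / r), ?_, ?_, ?_⟩
    · have hc1 : ContinuousOn (fun r => bornSol k F r * r ^ D) (Ioc 0 1) :=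
        (hbc.mono hsubI).mul (by fun_prop)
      refine LocallyIntegrableOn.add ?_ ?_
      · exact hI.locallyIntegrableOn.continuousOn_mul hc1 isLocallyClosed_Ioc
      · refine ContinuousOn.locallyIntegrableOn ?_ measurableSet_Ioc
        exact hc1.mul (continuousOn_const.div continuousOn_id fun s hs => (ne_of_gt hs.1))
    · intro x hx y hy hxy
      simp only [born_rpow_d]
      have hsub : Icc x y ⊆ Ioc 0 1 := fun t ht => ⟨hx.1.trans_le ht.1, ht.2.trans hy.2⟩
      have hfd : ∀ t ∈ Icc x y, HasDerivWithinAt (fun t => bornSol k F t / t ^ (2 * k))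
          (bornSol k F t / t ^ (2 * k) * ((F t - k) / t)) (Icc x y) t := by
        intro t ht
        have ht0 : 0 < t := (hsub ht).1
        have h := ((bornSol_deriv (k := k) hF ht0).div (hasDerivAt_pow (2 * k) t)
          (pow_ne_zero _ ht0.ne')).hasDerivWithinAt (s := Icc x y)
        convert! h using 1
        obtain ⟨j, rfl⟩ : ∃ j, k = j + 1 := ⟨k - 1, by omega⟩
        have e : 2 * (j + 1) - 1 = 2 * j + 1 := by omega
        rw [e]
        have := ht0.ne'
        push_cast
        field_simp
        ring
      have hfc : ContinuousOn (fun t => bornSol k F t / t ^ (2 * k) * ((F t - k) / t))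
          (Icc x y) := by
        have h1 : ContinuousOn (fun t => bornSol k F t) (Icc x y) := hbc.mono (hsub.trans hsubI)
        have h2 : ContinuousOn F (Icc x y) := hF.mono (hsub.trans hsubI)
        refine (h1.div (by fun_prop) ?_).mul ((h2.sub continuousOn_const).div continuousOn_id ?_)
        · intro t ht
          exact pow_ne_zero _ (hsub ht).1.ne'
        · intro t ht
          exact (hsub ht).1.ne'
      have hpi : ∀ u v : ℝ, IntervalIntegrable (fun s : ℝ => (k:ℝ) * (N * s ^ (N - 1))) volume u v :=
        fun u v => (Continuous.intervalIntegrable (by fun_prop) u v)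
      have hii : ∀ t ∈ Icc x y, IntervalIntegrable
          (fun s => s ^ N * (s * q s - F s ^ 2 / s)) volume x t := fun t ht =>
        born_ii hhint ⟨hx.1.le, hx.2⟩ ⟨(hsub ht).1.le, (hsub ht).2⟩
      have key := born_ibp hxy (H := fun t => t ^ N * (k + F t))
        (h := fun s => (k:ℝ) * (N * s ^ (N - 1)) + s ^ N * (s * q s - F s ^ 2 / s)) hfd hfc
        ((hpi x y).add (hii y (right_mem_Icc.2 hxy))) (by
          intro t ht
          have htI := hsub ht
          rw [intervalIntegral.integral_add (hpi x t) (hii t ht)]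
          have h1 : ∫ s in x..t, (k:ℝ) * (N * s ^ (N - 1)) = k * t ^ N - k * x ^ N := by
            refine intervalIntegral.integral_eq_sub_of_hasDerivAt (f := fun s => (k:ℝ) * s ^ N)
              (fun s _ => (hasDerivAt_pow N s).const_mul _) (hpi x t)
          have h2 : ∫ s in x..t, s ^ N * (s * q s - F s ^ 2 / s) = t ^ N * F t - x ^ N * F x := by
            rw [hR t htI, hR x hx]
            refine (intervalIntegral.integral_interval_sub_left ?_ ?_).symm
            · exact born_ii hhint (by simp) ⟨htI.1.le, htI.2⟩
            · exact born_ii hhint (by simp) ⟨hx.1.le, hx.2⟩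
          rw [h1, h2]; ring)
      have hval : ∀ t ∈ Ioc (0:ℝ) 1, t ^ (D + 1) * (bornSol k F t * ((k + F t) / t))
          = bornSol k F t / t ^ (2 * k) * (t ^ N * (k + F t)) := by
        intro t ht
        have := ht.1.ne'
        rw [hN]
        field_simp
        ring
      rw [hval y hy, hval x hx, key]
      refine intervalIntegral.integral_congr_ae (Filter.Eventually.of_forall ?_)
      intro t ht
      rw [uIoc_of_le hxy] at ht
      have htI := hsub (Ioc_subset_Icc_self ht)
      have := htI.1.ne'
      obtain ⟨j, hj⟩ : ∃ j, N = j + 1 := ⟨N - 1, by omega⟩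
      have hNr : (N:ℝ) = 2 * k + D := by rw [hN]; push_cast; ring
      have e0 : t ^ (N - 1) = t ^ (2 * k) * t ^ D / t := by
        rw [← pow_add, ← hN, hj, Nat.add_sub_cancel, pow_succ]; field_simp
      have e1 : t ^ N = t ^ (2 * k) * t ^ D := by rw [hN, pow_add]
      rw [e0, e1, hNr]
      field_simp
      ring
    · filter_upwards [ae_restrict_mem measurableSet_Ioo] with r hr
      rw [born_rpow_d]
      have := hr.1.ne'
      push_cast
      field_simp
      ring
  · refine lt_of_le_of_lt (lintegral_mono_ae (g := fun _ => 1) ?_) (by simp)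
    filter_upwards [ae_restrict_mem measurableSet_Ioo] with r hr
    rw [born_rpow_d2, ENNReal.ofReal_le_one]
    have h1 := bornSol_le hF hFa hk (Ioo_subset_Ioc_self hr)
    have h2 := bornSol_pos k F r
    have h3 : bornSol k F r ≤ 1 := h1.trans hr.2.le
    exact mul_le_one₀ (pow_le_one₀ h2.le h3) (pow_nonneg hr.1.le _) (pow_le_one₀ hr.1.le hr.2.le)

lemma born_aux {g P X : ℝ} (hP : P ≠ 0) (h : -g / P + X = 0) : g = P * X := by
  have h1 : X = g / P := by
    rw [neg_div] at h
    linarith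
  rw [h1]; field_simp

lemma born_unique {D k N : ℕ} (hN : N = 2 * k + D) {q F : ℝ → ℝ} (hq : Measurable q)
    (hI : IntegrableOn (fun s => s * q s) (Ioc 0 1)) (hF : ContinuousOn F (Ioi 0)) {a : ℝ}
    (hFa : ∀ r ∈ Ioc (0:ℝ) 1, |F r| ≤ a) (hk : a + 1 ≤ k)
    (hR : ∀ r ∈ Ioc (0:ℝ) 1, r ^ N * F r = ∫ s in (0:ℝ)..r, s ^ N * (s * q s - F s ^ 2 / s))
    {c c' : ℝ → ℝ} (hc : IsDtNSolution (D + 2) q k c c') :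
    EqOn c (bornSol k F) (Ioc 0 1) := by
  have hb := bornSol_isDtN hN hq hI hF hFa hk hR
  have ha : 0 ≤ a := (abs_nonneg _).trans (hFa 1 (by simp))
  have hk1 : (1:ℝ) ≤ k := by linarith
  set b := bornSol k F with hbdef
  set b' : ℝ → ℝ := fun r => b r * ((k + F r) / r) with hb'def
  have hbd : ∀ r : ℝ, 0 < r → HasDerivAt b (b' r) r := fun r hr => bornSol_deriv hF hr
  have hbpos : ∀ r, 0 < b r := fun r => bornSol_pos k F r
  have hble : ∀ r ∈ Ioc (0:ℝ) 1, b r ≤ r := fun r hr => bornSol_le hF hFa hk hr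
  have hb1 : b 1 = 1 := bornSol_one k F
  obtain ⟨⟨hcd, hcc, gc, hgc, hcF, hcE⟩, hc1, hcL⟩ := hc
  obtain ⟨⟨_, hbc, gb, hgb, hbF, hbE⟩, _, _⟩ := hb
  simp only [born_rpow_d] at hcF hbF hcE hbE
  -- the Wronskian is constant
  have hW : ∀ x ∈ Ioc (0:ℝ) 1, x ^ (D + 1) * (b x * c' x - c x * b' x) = c' 1 - b' 1 := by
    intro x hx
    have hsub : Icc x 1 ⊆ Ioc 0 1 := fun t ht => ⟨hx.1.trans_le ht.1, ht.2⟩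
    have h1 := born_ibp hx.2 (f := b) (f' := b') (H := fun t => t ^ (D + 1) * c' t) (h := gc)
      (fun t ht => (hbd t (hsub ht).1).hasDerivWithinAt) (hbc.mono hsub)
      (by
        rw [intervalIntegrable_iff_integrableOn_Icc_of_le hx.2]
        exact hgc.integrableOn_compact_subset hsub isCompact_Icc)
      (fun t ht => hcF x hx t (hsub ht) ht.1)
    have h2 := born_ibp hx.2 (f := c) (f' := c') (H := fun t => t ^ (D + 1) * b' t) (h := gb)
      (fun t ht => (hcd t (hsub ht)).mono hsub) (hcc.mono hsub)
      (by
        rw [intervalIntegrable_iff_integrableOn_Icc_of_le hx.2]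
        exact hgb.integrableOn_compact_subset hsub isCompact_Icc)
      (fun t ht => hbF x hx t (hsub ht) ht.1)
    have h3 : ∫ t in x..1, (b' t * (t ^ (D + 1) * c' t) + b t * gc t)
        = ∫ t in x..1, (c' t * (t ^ (D + 1) * b' t) + c t * gb t) := by
      apply intervalIntegral.integral_congr_ae
      rw [ae_restrict_iff' measurableSet_Ioo] at hcE hbE
      have hne : ∀ᵐ t : ℝ, t ≠ 1 := by simp [ae_iff, measure_singleton]
      filter_upwards [hcE, hbE, hne] with t h4 h5 h6 h7
      rw [uIoc_of_le hx.2] at h7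
      have ht : t ∈ Ioo (0:ℝ) 1 := ⟨hx.1.trans h7.1, lt_of_le_of_ne h7.2 h6⟩
      have h4 := h4 ht
      have h5 := h5 ht
      have hp : t ^ (D + 1) ≠ 0 := pow_ne_zero _ ht.1.ne'
      have e1 := born_aux hp h4
      have e2 := born_aux hp h5
      rw [e1, e2]; ring
    rw [h3, ← h2] at h1
    simp only [hb1, hc1, one_pow, one_mul] at h1
    linarith
  set w := c' 1 - b' 1 with hw
  -- derivative of the quotient
  have hyd : ∀ r ∈ Ioo (0:ℝ) 1, HasDerivAt (fun r => c r / b r) (w / (r ^ (D + 1) * b r ^ 2)) r := by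
    intro r hr
    have hcr : HasDerivAt c (c' r) r :=
      (hcd r (Ioo_subset_Ioc_self hr)).hasDerivAt (Ioc_mem_nhds hr.1 hr.2)
    convert! hcr.div (hbd r hr.1) (hbpos r).ne' using 1
    rw [← hW r (Ioo_subset_Ioc_self hr)]
    have := (hbpos r).ne'
    have := hr.1.ne'
    field_simp
  have hbcont : ContinuousOn b (Ioc 0 1) :=
    fun r hr => (hbd r hr.1).continuousAt.continuousWithinAt
  have hyc : ContinuousOn (fun r => c r / b r) (Ioc 0 1) :=
    ContinuousOn.div (fun r hr => (hcd r hr).continuousWithinAt) hbcont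
      fun r _ => (hbpos r).ne'
  have h1mem : (1:ℝ) ∈ Ioc (0:ℝ) 1 := right_mem_Ioc.2 one_pos
  by_cases hw0 : w = 0
  · have hmono : MonotoneOn (fun r => c r / b r) (Ioc 0 1) := by
      refine monotoneOn_of_hasDerivWithinAt_nonneg (convex_Ioc 0 1) hyc (f' := fun _ => 0) ?_ ?_
      · intro s hs
        rw [interior_Ioc] at hs
        have := hyd s hs
        rw [hw0, zero_div] at this
        exact this.hasDerivWithinAt
      · intro s _
        exact le_rfl
    have hanti : AntitoneOn (fun r => c r / b r) (Ioc 0 1) := by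
      refine antitoneOn_of_hasDerivWithinAt_nonpos (convex_Ioc 0 1) hyc (f' := fun _ => 0) ?_ ?_
      · intro s hs
        rw [interior_Ioc] at hs
        have := hyd s hs
        rw [hw0, zero_div] at this
        exact this.hasDerivWithinAt
      · intro s _
        exact le_rfl
    intro r hr
    have h2 := hmono hr h1mem hr.2
    have h3 := hanti hr h1mem hr.2
    simp only [hb1, hc1, div_one] at h2 h3
    have h4 : c r / b r = 1 := le_antisymm h2 h3
    rwa [div_eq_one_iff_eq (hbpos r).ne'] at h4
  · exfalso
    set θ : ℝ := 1 / (2 * k + 2 * a + D) with hθ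
    have hden : 0 < 2 * (k:ℝ) + 2 * a + D := by positivity
    have hθ0 : 0 < θ := by positivity
    have hbD : ∀ r ∈ Ioo (0:ℝ) 1, HasDerivAt (fun r => (b r ^ 2 * r ^ D)⁻¹)
        (-((2 * (k + F r) + D) / (r ^ (D + 1) * b r ^ 2))) r := by
      intro r hr
      have hne : b r ^ 2 * r ^ D ≠ 0 :=
        mul_ne_zero (pow_ne_zero _ (hbpos r).ne') (pow_ne_zero _ hr.1.ne')
      have h := (((hbd r hr.1).pow 2).mul (hasDerivAt_pow D r)).inv hne
      convert! h using 1
      have := (hbpos r).ne'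
      have := hr.1.ne'
      simp only [hb'def, Pi.mul_apply, Pi.pow_apply]
      rcases Nat.eq_zero_or_pos D with h0 | h0
      · rw [h0]; simp; field_simp
      · obtain ⟨j, rfl⟩ : ∃ j, D = j + 1 := ⟨D - 1, by omega⟩
        simp only [Nat.add_sub_cancel]
        push_cast
        field_simp
        ring
    have hanti : AntitoneOn (fun r => -(c r / b r - 1) / w - θ * ((b r ^ 2 * r ^ D)⁻¹ - 1))
        (Ioc 0 1) := by
      refine antitoneOn_of_hasDerivWithinAt_nonpos (convex_Ioc 0 1) ?_
        (f' := fun r => -(w / (r ^ (D + 1) * b r ^ 2)) / w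
          - θ * (-((2 * (k + F r) + D) / (r ^ (D + 1) * b r ^ 2)))) ?_ ?_
      · refine ContinuousOn.sub ?_ ?_
        · exact ((hyc.sub continuousOn_const).neg).div_const w
        · refine continuousOn_const.mul (ContinuousOn.sub (ContinuousOn.inv₀ ?_ ?_) continuousOn_const)
          · exact (hbcont.pow 2).mul (by fun_prop)
          · intro r hr
            exact mul_ne_zero (pow_ne_zero _ (hbpos r).ne') (pow_ne_zero _ hr.1.ne')
      · intro r hr
        rw [interior_Ioc] at hr
        exact (((((hyd r hr).sub_const 1).neg).div_const w).sub
          (((hbD r hr).sub_const 1).const_mul θ)).hasDerivWithinAt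
      · intro r hr
        rw [interior_Ioc] at hr
        have hr0 := hr.1
        have hbr := hbpos r
        have hF1 := (le_abs_self _).trans (hFa r (Ioo_subset_Ioc_self hr))
        have e : -(w / (r ^ (D + 1) * b r ^ 2)) / w
          - θ * (-((2 * (k + F r) + D) / (r ^ (D + 1) * b r ^ 2)))
          = (θ * (2 * (k + F r) + D) - 1) * (1 / (r ^ (D + 1) * b r ^ 2)) := by
          field_simp
          ring
        rw [e]
        refine mul_nonpos_of_nonpos_of_nonneg ?_ (by positivity)
        have h2 : θ * (2 * (k + F r) + D) ≤ θ * (2 * k + 2 * a + D) := by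
          apply mul_le_mul_of_nonneg_left _ hθ0.le
          linarith
        have h3 : θ * (2 * k + 2 * a + D) = 1 := by rw [hθ]; field_simp
        linarith
    have hlow : ∀ r ∈ Ioo (0:ℝ) (1/2), (w * θ / 2) ^ 2 * r⁻¹ ≤ 2 * (c r ^ 2 * r ^ D) + 2 := by
      intro r hr
      have hr0 : 0 < r := hr.1
      have hr1 : r ∈ Ioc (0:ℝ) 1 := ⟨hr.1, by linarith [hr.2]⟩
      have hbr := hbpos r
      have hbr1 := hble r hr1
      have h2 := hanti hr1 h1mem hr1.2
      simp only [hb1, hc1, one_pow, mul_one, inv_one, div_one, sub_self, neg_zero, zero_div,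
        mul_zero] at h2
      have hrD : 0 < r ^ D := by positivity
      have hrD1 : r ^ D ≤ 1 := pow_le_one₀ hr1.1.le hr1.2
      -- lower bound of |c - b|
      have h3 : θ * ((b r ^ 2 * r ^ D)⁻¹ - 1) * b r ≤ (b r - c r) / w := by
        have : (b r - c r) / w = (-(c r / b r - 1) / w) * b r := by field_simp; ring
        rw [this]
        apply mul_le_mul_of_nonneg_right _ hbr.le
        linarith
      have h4 : 1 / (2 * r * r ^ D) ≤ ((b r ^ 2 * r ^ D)⁻¹ - 1) * b r := by
        have e : ((b r ^ 2 * r ^ D)⁻¹ - 1) * b r = 1 / (b r * r ^ D) - b r := by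
          field_simp
        rw [e]
        have h5 : 1 / (r * r ^ D) ≤ 1 / (b r * r ^ D) := by
          apply one_div_le_one_div_of_le (by positivity)
          exact mul_le_mul_of_nonneg_right hbr1 hrD.le
        have h6 : r ≤ 1 / (2 * r * r ^ D) := by
          rw [le_div_iff₀ (by positivity)]
          have : r * (2 * r * r ^ D) = 2 * r ^ 2 * r ^ D := by ring
          rw [this]
          have : 2 * r ^ 2 ≤ 1 := by nlinarith [hr.2]
          exact mul_le_one₀ this hrD.le hrD1
        have h7 : 1 / (r * r ^ D) = 1 / (2 * r * r ^ D) + 1 / (2 * r * r ^ D) := by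
          field_simp; norm_num
        linarith
      have h8 : θ * (1 / (2 * r * r ^ D)) ≤ (b r - c r) / w := by
        refine le_trans ?_ h3
        rw [mul_assoc θ]
        exact mul_le_mul_of_nonneg_left h4 hθ0.le
      have h9 : (θ * (1 / (2 * r * r ^ D))) ^ 2 ≤ ((b r - c r) / w) ^ 2 :=
        pow_le_pow_left₀ (by positivity) h8 2
      have h10 : (w * θ / 2) ^ 2 * (1 / (r ^ 2 * (r ^ D) ^ 2)) ≤ (b r - c r) ^ 2 := by
        have h := mul_le_mul_of_nonneg_left h9 (sq_nonneg w)
        have e1 : w ^ 2 * ((b r - c r) / w) ^ 2 = (b r - c r) ^ 2 := by field_simp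
        have e2 : w ^ 2 * (θ * (1 / (2 * r * r ^ D))) ^ 2
            = (w * θ / 2) ^ 2 * (1 / (r ^ 2 * (r ^ D) ^ 2)) := by field_simp
        rw [e1, e2] at h
        exact h
      have h11 : (b r - c r) ^ 2 ≤ 2 * c r ^ 2 + 2 * b r ^ 2 := by nlinarith [sq_nonneg (b r + c r)]
      have h12 : (w * θ / 2) ^ 2 * (1 / (r ^ 2 * (r ^ D) ^ 2)) * r ^ D
          ≤ (2 * c r ^ 2 + 2 * b r ^ 2) * r ^ D :=
        mul_le_mul_of_nonneg_right (h10.trans h11) hrD.le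
      have h13 : r⁻¹ ≤ 1 / (r ^ 2 * (r ^ D) ^ 2) * r ^ D := by
        have e : 1 / (r ^ 2 * (r ^ D) ^ 2) * r ^ D = 1 / (r * (r * r ^ D)) := by field_simp
        rw [e, inv_eq_one_div]
        apply one_div_le_one_div_of_le (by positivity)
        have : r * r ^ D ≤ 1 := mul_le_one₀ hr1.2 hrD.le hrD1
        nlinarith
      have h14 := mul_le_mul_of_nonneg_left h13 (sq_nonneg (w * θ / 2))
      have h15 : b r ^ 2 * r ^ D ≤ 1 :=
        mul_le_one₀ (pow_le_one₀ hbr.le (hbr1.trans hr1.2)) hrD.le hrD1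
      have e3 : (2 * c r ^ 2 + 2 * b r ^ 2) * r ^ D
          = 2 * (c r ^ 2 * r ^ D) + 2 * (b r ^ 2 * r ^ D) := by ring
      rw [e3, mul_assoc] at h12
      linarith
    -- contradiction with the integrability
    have hcint : IntegrableOn (fun r => c r ^ 2 * r ^ D) (Ioo 0 1) := by
      refine ⟨?_, ?_⟩
      · refine ContinuousOn.aestronglyMeasurable ?_ measurableSet_Ioo
        refine ContinuousOn.mul ?_ (by fun_prop)
        exact ContinuousOn.pow (fun r hr => ((hcd r (Ioo_subset_Ioc_self hr)).continuousWithinAt.mono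
          Ioo_subset_Ioc_self)) 2
      · rw [hasFiniteIntegral_iff_ofReal]
        · simpa only [born_rpow_d2] using hcL
        · filter_upwards [ae_restrict_mem measurableSet_Ioo] with r hr
          have := hr.1
          show 0 ≤ c r ^ 2 * r ^ D
          positivity
    have hbi : IntegrableOn (fun r => 2 * (c r ^ 2 * r ^ D) + 2) (Ioo 0 (1/2)) := by
      refine Integrable.add ?_ (integrable_const _)
      exact (hcint.mono_set (Ioo_subset_Ioo le_rfl (by norm_num))).const_mul 2
    have hinv : IntegrableOn (fun r : ℝ => (w * θ / 2) ^ 2 * r⁻¹) (Ioo 0 (1/2)) := by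
      refine Integrable.mono' hbi (by fun_prop) ?_
      filter_upwards [ae_restrict_mem measurableSet_Ioo] with r hr
      have := hr.1
      rw [Real.norm_eq_abs, abs_of_nonneg (by positivity)]
      exact hlow r hr
    have hK : (w * θ / 2) ^ 2 ≠ 0 := by positivity
    have hinv2 : IntegrableOn (fun r : ℝ => r⁻¹) (Ioo 0 (1/2)) := by
      have := hinv.const_mul ((w * θ / 2) ^ 2)⁻¹
      refine this.congr (Filter.Eventually.of_forall fun r => ?_)
      simp only
      rw [inv_mul_cancel_left₀ hK]
    have h3 : IntervalIntegrable (fun r : ℝ => r⁻¹) volume 0 (1/2) := by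
      rw [intervalIntegrable_iff_integrableOn_Ioo_of_le (by norm_num)]
      exact hinv2
    rw [intervalIntegrable_inv_iff] at h3
    rcases h3 with h3 | h3
    · norm_num at h3
    · exact h3 (by simp)

lemma born_lambda {D k N : ℕ} (hN : N = 2 * k + D) {q F : ℝ → ℝ} (hq : Measurable q)
    (hI : IntegrableOn (fun s => s * q s) (Ioc 0 1)) (hF : ContinuousOn F (Ioi 0)) {a : ℝ}
    (hFa : ∀ r ∈ Ioc (0:ℝ) 1, |F r| ≤ a) (hk : a + 1 ≤ k)
    (hR : ∀ r ∈ Ioc (0:ℝ) 1, r ^ N * F r = ∫ s in (0:ℝ)..r, s ^ N * (s * q s - F s ^ 2 / s))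
    {lam : ℝ} (hlam : IsGenEigenvalue (D + 2) q k lam) : lam = k + F 1 := by
  have hb := bornSol_isDtN hN hq hI hF hFa hk hR
  have h1mem : (1:ℝ) ∈ Ioc (0:ℝ) 1 := right_mem_Ioc.2 one_pos
  rcases hlam with ⟨b, b', ⟨hb0, hu⟩, hl⟩ | ⟨hno, _⟩
  · have heq := hu _ _ hb
    have hd1 := hb.1.1 1 h1mem
    have hd2 := hb0.1.1 1 h1mem
    have hd3 := hd2.congr heq (heq h1mem)
    have := (uniqueDiffOn_Ioc (0:ℝ) 1 1 h1mem).eq_deriv _ hd3 hd1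
    rw [← hl, this]
    simp only [bornSol_one]
    ring
  · exact absurd ⟨_, _, hb, fun c c' hc => born_unique hN hq hI hF hFa hk hR hc⟩ hno

lemma born_dual {μ : Measure ℝ} [IsFiniteMeasure μ] (hμ : ∀ᵐ r ∂μ, r ∈ Ico (0:ℝ) 1)
    {w : ℝ → ℝ} {K : ℕ} {e C : ℝ} (he : 0 ≤ e)
    (hint : Integrable (fun r => w r * r ^ (2 * K)) μ)
    (hyp : ∀ (P : Polynomial ℝ) (B : ℝ), (∀ ρ ∈ Ioc (0:ℝ) 1, |P.eval (ρ ^ 2)| * ρ ^ e ≤ B) →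
      |∫ r, w r * r ^ (2 * K) * P.eval (r ^ 2) ∂μ| ≤ C * B)
    {ε : ℝ} (hε : 0 < ε) :
    Integrable (fun r => w r * r ^ (2 * K) / (max r ε) ^ e) μ ∧
    ∫ r, |w r * r ^ (2 * K) / (max r ε) ^ e| ∂μ ≤ C := by
  have hmax : ∀ r : ℝ, 0 < max r ε := fun r => lt_max_of_lt_right hε
  have hmc : Continuous (fun r : ℝ => ((max r ε) ^ e)⁻¹) := by
    refine Continuous.inv₀ ?_ fun r => (Real.rpow_pos_of_pos (hmax r) e).ne'
    exact (continuous_id.max continuous_const).rpow_const fun r => Or.inl (hmax r).ne'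
  have hmb : ∀ r : ℝ, ‖((max r ε) ^ e)⁻¹‖ ≤ (ε ^ e)⁻¹ := by
    intro r
    have h1 := Real.rpow_pos_of_pos (hmax r) e
    rw [Real.norm_eq_abs, abs_of_pos (inv_pos.2 h1)]
    exact inv_anti₀ (Real.rpow_pos_of_pos hε e)
      (Real.rpow_le_rpow hε.le (le_max_right _ _) he)
  have hu : Integrable (fun r => w r * r ^ (2 * K) / (max r ε) ^ e) μ := by
    simp only [div_eq_mul_inv]
    exact hint.mul_bdd hmc.aestronglyMeasurable (Filter.Eventually.of_forall hmb)
  refine ⟨hu, ?_⟩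
  set u : ℝ → ℝ := fun r => w r * r ^ (2 * K) / (max r ε) ^ e with hudef
  set L : ℝ := ∫ r, |w r * r ^ (2 * K)| ∂μ with hL
  set m : ℝ := μ.real univ with hm
  have main : ∀ η : ℝ, 0 < η → ∫ r, |u r| ∂μ ≤ C + η * (C + L + 2 + m) := by
    intro η hη
    obtain ⟨h, hh, hhi⟩ := hu.exists_boundedContinuous_integral_sub_le hη
    set φ : ℝ → ℝ := fun r => h r / (|h r| + η) with hφ
    have hden : ∀ r, 0 < |h r| + η := fun r => by positivity
    have hφc : Continuous φ := by
      refine h.continuous.div (h.continuous.abs.add continuous_const) fun r => (hden r).ne'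
    have hφ1 : ∀ r, |φ r| ≤ 1 := by
      intro r
      simp only [hφ]
      rw [abs_div, abs_of_pos (hden r), div_le_one (hden r)]
      linarith
    set ψ : ℝ → ℝ := fun r => φ r * ((max r ε) ^ e)⁻¹ with hψ
    have hψc : Continuous ψ := hφc.mul hmc
    obtain ⟨P, hP⟩ := exists_polynomial_near_of_continuousOn 0 1 (fun t => ψ (Real.sqrt t))
      ((hψc.comp Real.continuous_sqrt).continuousOn) η hη
    have hP2 : ∀ r ∈ Icc (0:ℝ) 1, |P.eval (r ^ 2) - ψ r| ≤ η := by
      intro r hr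
      have := hP (r ^ 2) ⟨by positivity, pow_le_one₀ hr.1 hr.2⟩
      simp only [Real.sqrt_sq hr.1] at this
      exact this.le
    have hb := hyp P (1 + η) (by
      intro ρ hρ
      have h1 := hP2 ρ (Ioc_subset_Icc_self hρ)
      have hρe : 0 ≤ ρ ^ e := Real.rpow_nonneg hρ.1.le e
      have hρ1 : ρ ^ e ≤ 1 := Real.rpow_le_one hρ.1.le hρ.2 he
      have h2 : |ψ ρ| * ρ ^ e ≤ 1 := by
        have h3 := Real.rpow_pos_of_pos (hmax ρ) e
        simp only [hψ]
        rw [abs_mul, abs_of_pos (inv_pos.2 h3), mul_assoc]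
        refine mul_le_one₀ (hφ1 ρ) (by positivity) ?_
        rw [inv_mul_le_one₀ h3]
        exact Real.rpow_le_rpow hρ.1.le (le_max_left _ _) he
      have h4 : |P.eval (ρ ^ 2)| ≤ |ψ ρ| + η := by
        have := abs_sub_abs_le_abs_sub (P.eval (ρ ^ 2)) (ψ ρ)
        linarith
      have h5 := mul_le_mul_of_nonneg_right h4 hρe
      nlinarith)
    have hPc : Continuous fun r : ℝ => P.eval (r ^ 2) := P.continuous.comp (continuous_pow 2)
    have hψb : ∀ r, ‖ψ r‖ ≤ (ε ^ e)⁻¹ := by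
      intro r
      simp only [hψ]
      rw [norm_mul]
      have := hmb r
      have h2 := hφ1 r
      rw [← Real.norm_eq_abs] at h2
      have := mul_le_mul h2 this (norm_nonneg _) zero_le_one
      linarith
    have hψi : Integrable (fun r => w r * r ^ (2 * K) * ψ r) μ :=
      hint.mul_bdd hψc.aestronglyMeasurable (Filter.Eventually.of_forall hψb)
    have hPi : Integrable (fun r => w r * r ^ (2 * K) * P.eval (r ^ 2)) μ := by
      refine hint.mul_bdd (c := η + (ε ^ e)⁻¹) hPc.aestronglyMeasurable ?_
      filter_upwards [hμ] with r hr
      have h1 := hP2 r ⟨hr.1, hr.2.le⟩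
      have h2 := hψb r
      rw [Real.norm_eq_abs] at h2 ⊢
      have := abs_sub_abs_le_abs_sub (P.eval (r ^ 2)) (ψ r)
      linarith
    have hdiff : ∫ r, w r * r ^ (2 * K) * ψ r ∂μ - ∫ r, w r * r ^ (2 * K) * P.eval (r ^ 2) ∂μ
        ≤ η * L := by
      rw [← integral_sub hψi hPi, hL, ← integral_const_mul]
      refine integral_mono_ae (hψi.sub hPi) (hint.abs.const_mul η) ?_
      filter_upwards [hμ] with r hr
      have h1 := hP2 r ⟨hr.1, hr.2.le⟩
      rw [abs_sub_comm] at h1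
      calc w r * r ^ (2 * K) * ψ r - w r * r ^ (2 * K) * P.eval (r ^ 2)
          = (w r * r ^ (2 * K)) * (ψ r - P.eval (r ^ 2)) := by ring
        _ ≤ |(w r * r ^ (2 * K)) * (ψ r - P.eval (r ^ 2))| := le_abs_self _
        _ = |w r * r ^ (2 * K)| * |ψ r - P.eval (r ^ 2)| := abs_mul _ _
        _ ≤ |w r * r ^ (2 * K)| * η := mul_le_mul_of_nonneg_left h1 (abs_nonneg _)
        _ = η * |w r * r ^ (2 * K)| := mul_comm _ _
    have hlow : ∫ r, |u r| ∂μ ≤ ∫ r, w r * r ^ (2 * K) * ψ r ∂μ + (2 * η + η * m) := by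
      have hn : Integrable (fun r => ‖u r - h r‖) μ := (hu.sub hhi).norm
      have hd : Integrable (fun r => 2 * ‖u r - h r‖ + η) μ :=
        (hn.const_mul 2).add (integrable_const η)
      have h1 : ∫ r, |u r| ∂μ ≤ ∫ r, (w r * r ^ (2 * K) * ψ r + (2 * ‖u r - h r‖ + η)) ∂μ := by
        refine integral_mono hu.abs (hψi.add hd) ?_
        intro r
        have e1 : w r * r ^ (2 * K) * ψ r = u r * φ r := by
          simp only [hψ, hudef]; ring
        show |u r| ≤ w r * r ^ (2 * K) * ψ r + (2 * ‖u r - h r‖ + η)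
        rw [e1, Real.norm_eq_abs]
        have h2 : |h r| - η ≤ h r * φ r := by
          have : h r * φ r = |h r| ^ 2 / (|h r| + η) := by
            simp only [hφ]; rw [sq_abs]; ring
          rw [this, le_div_iff₀ (hden r)]
          nlinarith
        have h3 : -|u r - h r| ≤ (u r - h r) * φ r := by
          have h4 : |(u r - h r) * φ r| ≤ |u r - h r| := by
            rw [abs_mul]
            exact mul_le_of_le_one_right (abs_nonneg _) (hφ1 r)
          have := neg_abs_le ((u r - h r) * φ r)
          linarith
        have h5 := abs_sub_abs_le_abs_sub (u r) (h r)
        have h6 : u r * φ r = h r * φ r + (u r - h r) * φ r := by ring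
        linarith
      rw [integral_add hψi hd, integral_add (hn.const_mul 2) (integrable_const η),
        integral_const_mul, integral_const, smul_eq_mul] at h1
      have hh' : ∫ r, ‖u r - h r‖ ∂μ ≤ η := hh
      have : m * η = η * m := mul_comm _ _
      simp only [← hm] at h1
      linarith
    have h3 := (le_abs_self _).trans hb
    linarith
  by_contra hcon
  push Not at hcon
  set X := ∫ r, |u r| ∂μ with hX
  have h0 := main 1 one_pos
  have hpos : 0 < C + L + 2 + m := by linarith
  have := main ((X - C) / (2 * (C + L + 2 + m))) (by
    have : 0 < X - C := by linarith
    positivity)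
  have e : (X - C) / (2 * (C + L + 2 + m)) * (C + L + 2 + m) = (X - C) / 2 := by
    field_simp
  rw [e] at this
  linarith

lemma born_holder {D : ℕ} {p M : ℝ} (hp : ((D:ℝ) + 2) / 2 < p) {q : ℝ → ℝ} (hq : Measurable q)
    (hM : 0 < M)
    (hJ : IntegrableOn (fun s => s ^ (D + 1) * |q s| ^ p) (Ioo 0 1))
    (hJle : (∫ s in Ioo (0:ℝ) 1, s ^ (D + 1) * |q s| ^ p) ^ (1 / p)
      ≤ (p - ((D:ℝ) + 2) / 2) / (p - 1) * M / 4) :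
    IntegrableOn (fun s => s * q s) (Ioc 0 1) ∧ ∫ s in (0:ℝ)..1, |s * q s| ≤ M / 4 := by
  have hD : (0:ℝ) ≤ D := Nat.cast_nonneg D
  have hp1 : 1 < p := by linarith
  have hp0 : 0 < p := by linarith
  have hpm : 0 < p - 1 := by linarith
  set c : ℝ := (p - ((D:ℝ) + 2) / 2) / (p - 1) with hc
  have hc0 : 0 < c := div_pos (by linarith) hpm
  have hc1 : c ≤ 1 := by
    rw [hc, div_le_one hpm]; linarith
  set p' : ℝ := p.conjExponent with hp'
  have hpq : p.HolderConjugate p' := Real.HolderConjugate.conjExponent hp1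
  have hp'0 : 0 < p' := hpq.symm.pos
  have hp'1 : 1 < p' := hpq.symm.lt
  have hp'e : p' = p / (p - 1) := rfl
  set μ : Measure ℝ := volume.restrict (Ioo (0:ℝ) 1) with hμ
  have hmem : ∀ᵐ s ∂μ, s ∈ Ioo (0:ℝ) 1 := ae_restrict_mem measurableSet_Ioo
  set f : ℝ → ℝ := fun s => s ^ (((D:ℝ) + 1) / p) * |q s| with hf
  set g : ℝ → ℝ := fun s => s ^ (1 - ((D:ℝ) + 1) / p) with hg
  have hfm : Measurable f := (measurable_id.pow_const _).mul hq.abs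
  have hgm : Measurable g := measurable_id.pow_const _
  have hf0 : 0 ≤ᵐ[μ] f := by
    filter_upwards [hmem] with s hs
    exact mul_nonneg (Real.rpow_nonneg hs.1.le _) (abs_nonneg _)
  have hg0 : 0 ≤ᵐ[μ] g := by
    filter_upwards [hmem] with s hs
    exact Real.rpow_nonneg hs.1.le _
  have hfp : ∀ s ∈ Ioo (0:ℝ) 1, f s ^ p = s ^ (D + 1) * |q s| ^ p := by
    intro s hs
    simp only [hf]
    rw [Real.mul_rpow (Real.rpow_nonneg hs.1.le _) (abs_nonneg _), ← Real.rpow_mul hs.1.le,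
      div_mul_cancel₀ _ hp0.ne', ← Real.rpow_natCast]
    push_cast
    rfl
  have hgp : ∀ s ∈ Ioo (0:ℝ) 1, g s ^ p' = s ^ (2 * c - 1) := by
    intro s hs
    simp only [hg]
    rw [← Real.rpow_mul hs.1.le, hp'e, hc]
    congr 1
    field_simp
    ring
  have hfL : MemLp f (ENNReal.ofReal p) μ := by
    rw [← integrable_norm_rpow_iff hfm.aestronglyMeasurable (by simpa using hp0) ENNReal.ofReal_ne_top,
      ENNReal.toReal_ofReal hp0.le]
    refine Integrable.congr hJ ?_
    filter_upwards [hmem, hf0] with s hs h0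
    rw [Real.norm_of_nonneg h0, hfp s hs]
  have hgI : IntegrableOn (fun s : ℝ => s ^ (2 * c - 1)) (Ioc 0 1) := by
    have := (intervalIntegral.intervalIntegrable_rpow' (a := 0) (b := 1)
      (r := 2 * c - 1) (by linarith)).1
    exact this
  have hgL : MemLp g (ENNReal.ofReal p') μ := by
    rw [← integrable_norm_rpow_iff hgm.aestronglyMeasurable (by simpa using hp'0) ENNReal.ofReal_ne_top,
      ENNReal.toReal_ofReal hp'0.le]
    refine Integrable.congr (hgI.mono_set Ioo_subset_Ioc_self) ?_
    filter_upwards [hmem, hg0] with s hs h0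
    rw [Real.norm_of_nonneg h0, hgp s hs]
  have hfg : ∀ s ∈ Ioo (0:ℝ) 1, f s * g s = |s * q s| := by
    intro s hs
    simp only [hf, hg]
    rw [mul_right_comm, ← Real.rpow_add hs.1, abs_mul, abs_of_pos hs.1]
    simp
  have hE : Integrable (fun s => |s * q s|) μ := by
    have : (ENNReal.ofReal p).HolderConjugate (ENNReal.ofReal p') := hpq.ennrealOfReal
    refine Integrable.congr (hfL.integrable_mul hgL) ?_
    filter_upwards [hmem] with s hs
    exact hfg s hs
  have hE2 : Integrable (fun s => s * q s) μ :=
    (integrable_norm_iff (measurable_id.mul hq).aestronglyMeasurable).1 hE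
  refine ⟨?_, ?_⟩
  · rw [integrableOn_Ioc_iff_integrableOn_Ioo]; exact hE2
  rw [intervalIntegral.integral_of_le zero_le_one, integral_Ioc_eq_integral_Ioo]
  have h1 := integral_mul_le_Lp_mul_Lq_of_nonneg hpq hf0 hg0 hfL hgL
  rw [setIntegral_congr_fun measurableSet_Ioo hfg, setIntegral_congr_fun measurableSet_Ioo hfp,
    setIntegral_congr_fun measurableSet_Ioo hgp] at h1
  have h2 : ∫ s in Ioo (0:ℝ) 1, s ^ (2 * c - 1) = 1 / (2 * c) := by
    rw [← integral_Ioc_eq_integral_Ioo, ← intervalIntegral.integral_of_le zero_le_one,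
      integral_rpow (Or.inl (by linarith))]
    rw [sub_add_cancel, Real.one_rpow, Real.zero_rpow (by positivity), sub_zero]
  rw [h2] at h1
  have h3 : (1 / (2 * c)) ^ (1 / p') ≤ 1 / c := by
    have h4 : (1 / (2 * c)) ^ (1 / p') ≤ (1 / c) ^ (1 / p') := by
      apply Real.rpow_le_rpow (by positivity) _ (by positivity)
      exact one_div_le_one_div_of_le hc0 (by linarith)
    refine h4.trans ?_
    have h5 : 1 ≤ 1 / c := by rw [le_div_iff₀ hc0]; linarith
    have := Real.rpow_le_rpow_of_exponent_le h5 (show 1 / p' ≤ 1 by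
      rw [div_le_one hp'0]; exact hp'1.le)
    rwa [Real.rpow_one] at this
  refine h1.trans ?_
  have h6 := mul_le_mul hJle h3 (Real.rpow_nonneg (by positivity) _) (by positivity)
  refine h6.trans (le_of_eq ?_)
  field_simp

lemma born_sphereArea_pos (d : ℕ) (hd : 2 ≤ d) : 0 < sphereArea d := by
  unfold sphereArea
  have h1 : 0 < volume (Metric.ball (0 : Edim d) 1) := Metric.measure_ball_pos _ _ one_pos
  have h2 : volume (Metric.ball (0 : Edim d) 1) ≠ ⊤ := measure_ball_lt_top.ne
  have := ENNReal.toReal_pos h1.ne' h2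
  have h3 : (0:ℝ) < d := by exact_mod_cast (by omega : 0 < d)
  positivity

lemma born_Lp (d : ℕ) (hd : 2 ≤ d) {p M : ℝ} (hp : (d:ℝ) / 2 < p)
    {q : ℝ → ℝ} (hq : Measurable q) (hM : 0 < M)
    (hVp : eLpNorm (fun x : Edim d => q ‖x‖) (ENNReal.ofReal p) (volume.restrict (unitBall d))
        < ENNReal.ofReal (sphereArea d ^ (1/p) / 4 * ((p - (d:ℝ)/2) / (p - 1)) * M)) :
    IntegrableOn (fun s => s ^ (d - 1) * |q s| ^ p) (Ioo 0 1) ∧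
    (∫ s in Ioo (0:ℝ) 1, s ^ (d - 1) * |q s| ^ p) ^ (1 / p)
      ≤ (p - (d:ℝ) / 2) / (p - 1) * M / 4 := by
  have hd2 : (2:ℝ) ≤ d := by exact_mod_cast hd
  have hp0 : 0 < p := by linarith
  haveI : Nonempty (Fin d) := ⟨⟨0, by omega⟩⟩
  haveI : Nontrivial (Edim d) := inferInstance
  have hS := born_sphereArea_pos d hd
  have hqm : AEStronglyMeasurable (fun x : Edim d => q ‖x‖) (volume.restrict (unitBall d)) :=
    (hq.comp measurable_norm).aestronglyMeasurable
  have hL : MemLp (fun x : Edim d => q ‖x‖) (ENNReal.ofReal p) (volume.restrict (unitBall d)) :=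
    ⟨hqm, hVp.trans ENNReal.ofReal_lt_top⟩
  have hpz : ENNReal.ofReal p ≠ 0 := by simpa using hp0
  have hI := hL.integrable_norm_rpow hpz ENNReal.ofReal_ne_top
  rw [hL.eLpNorm_eq_integral_rpow_norm hpz ENNReal.ofReal_ne_top] at hVp
  rw [ENNReal.toReal_ofReal hp0.le] at hI hVp
  have hfin : Module.finrank ℝ (Edim d) = d := by simp
  have hJ : IntegrableOn (fun s => s ^ (d - 1) * |q s| ^ p) (Ioo 0 1) := by
    have := (integrableOn_fun_norm_addHaar (E := Edim d) volume (f := fun s => ‖q s‖ ^ p)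
      (r := 1)).1 hI
    rw [hfin] at this
    exact this
  refine ⟨hJ, ?_⟩
  have hint : ∫ x in unitBall d, ‖q ‖x‖‖ ^ p
      = sphereArea d * ∫ s in Ioo (0:ℝ) 1, s ^ (d - 1) * |q s| ^ p := by
    have h1 := integral_fun_norm_addHaar (E := Edim d) volume
      ((Iio (1:ℝ)).indicator fun s => ‖q s‖ ^ p)
    have h2 : (fun x : Edim d => (Iio (1:ℝ)).indicator (fun s => ‖q s‖ ^ p) ‖x‖)
        = (unitBall d).indicator (fun x => ‖q ‖x‖‖ ^ p) := by
      funext x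
      by_cases hx : ‖x‖ < 1
      · rw [indicator_of_mem (show ‖x‖ ∈ Iio (1:ℝ) from hx),
          indicator_of_mem (show x ∈ unitBall d by simpa [unitBall] using hx)]
      · rw [indicator_of_notMem (show ‖x‖ ∉ Iio (1:ℝ) from hx),
          indicator_of_notMem (show x ∉ unitBall d by simpa [unitBall] using hx)]
    rw [h2, integral_indicator (show MeasurableSet (unitBall d) from measurableSet_ball), hfin] at h1
    rw [h1, nsmul_eq_mul, smul_eq_mul, ← mul_assoc]
    congr 1
    rw [← Ioi_inter_Iio, ← setIntegral_indicator measurableSet_Iio]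
    congr 1
    funext s
    by_cases hs : s ∈ Iio (1:ℝ)
    · rw [indicator_of_mem hs, indicator_of_mem hs]; rfl
    · rw [indicator_of_notMem hs, indicator_of_notMem hs, smul_zero]
  have hJ0 : 0 ≤ ∫ s in Ioo (0:ℝ) 1, s ^ (d - 1) * |q s| ^ p := by
    refine setIntegral_nonneg measurableSet_Ioo fun s hs => ?_
    have := hs.1
    positivity
  have hlt := (ENNReal.ofReal_lt_ofReal_iff_of_nonneg (by positivity)).1 hVp
  rw [hint, Real.mul_rpow hS.le hJ0, ← one_div] at hlt
  have hSp : 0 < sphereArea d ^ (1 / p) := Real.rpow_pos_of_pos hS _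
  refine le_of_mul_le_mul_left ?_ hSp
  refine hlt.le.trans (le_of_eq ?_)
  ring

lemma born_eig {D : ℕ} {q : ℝ → ℝ} {M : ℝ} (hM : 0 < M) (hq : Measurable q)
    (hI : IntegrableOn (fun s => s * q s) (Ioc 0 1)) {F : ℕ → ℝ → ℝ}
    (hF1 : ∀ r ∈ Ioc (0:ℝ) 1, BornNorm M (fun n => F n r) (M / 2))
    (hF2 : ∀ n : ℕ, M < n → ContinuousOn (F n) (Ioc 0 1) ∧ ∀ r ∈ Ioc (0:ℝ) 1,
      r ^ n * F n r = ∫ s in (0:ℝ)..r, s ^ n * (s * q s - F n s ^ 2 / s))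
    {k : ℕ} (hk : M / 2 + 1 ≤ k) {lam : ℝ} (hlam : IsGenEigenvalue (D + 2) q k lam) :
    lam - k = F (2 * k + D) 1 := by
  have hn : M < ((2 * k + D : ℕ) : ℝ) := by
    push_cast
    have : (0:ℝ) ≤ D := Nat.cast_nonneg D
    linarith
  obtain ⟨hc, hR⟩ := hF2 _ hn
  set G : ℝ → ℝ := fun s => F (2 * k + D) (min s 1) with hG
  have hGe : ∀ s ∈ Ioc (0:ℝ) 1, G s = F (2 * k + D) s := by
    intro s hs
    simp only [hG, min_eq_left hs.2]
  have hGc : ContinuousOn G (Ioi 0) := by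
    refine hc.comp (continuous_id.min continuous_const).continuousOn ?_
    intro s hs
    exact ⟨lt_min hs one_pos, min_le_right _ _⟩
  have h := born_lambda (k := k) (D := D) (F := G) (a := M / 2) rfl hq hI hGc (by
      intro r hr
      rw [hGe r hr]
      exact (hF1 r hr).single hn) hk (by
      intro r hr
      rw [hGe r hr, hR r hr]
      refine intervalIntegral.integral_congr_ae ?_
      refine Filter.Eventually.of_forall fun s hs => ?_
      rw [uIoc_of_le hr.1.le] at hs
      rw [hGe s ⟨hs.1, hs.2.trans hr.2⟩]) hlam
  rw [h, hGe 1 (right_mem_Ioc.2 one_pos)]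
  ring

lemma born_poly {D K : ℕ} {M a : ℝ} (hM : 0 < M) (hK : M / 2 + 1 ≤ K) {f : ℕ → ℝ}
    (hf : BornNorm M f a) (P : Polynomial ℝ) (B : ℝ)
    (hP : ∀ ρ ∈ Ioc (0:ℝ) 1, |P.eval (ρ ^ 2)| * ρ ^ ((2 * K + D : ℝ) - M) ≤ B) :
    |∑ i ∈ Finset.range (P.natDegree + 1), P.coeff i * f (2 * (K + i) + D)| ≤ a * B := by
  have hD : (0:ℝ) ≤ D := Nat.cast_nonneg D
  set T := Finset.range (P.natDegree + 1)
  set g : ℕ → ℕ := fun i => 2 * (K + i) + D with hg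
  have hinj : Set.InjOn g T := by
    intro i _ j _ hij
    simp only [hg] at hij
    omega
  have hback : ∀ i, (g i - D) / 2 - K = i := by
    intro i
    simp only [hg]
    omega
  have := hf (T.image g) (fun n => P.coeff ((n - D) / 2 - K)) B (by
    intro n hn
    obtain ⟨i, _, rfl⟩ := Finset.mem_image.1 hn
    simp only [hg]
    push_cast
    have : (0:ℝ) ≤ i := Nat.cast_nonneg i
    linarith) (by
    intro ρ hρ
    rw [Finset.sum_image hinj]
    simp only [hback]
    have h1 : ∑ i ∈ T, P.coeff i * ρ ^ g i = ρ ^ (2 * K + D) * P.eval (ρ ^ 2) := by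
      rw [Polynomial.eval_eq_sum_range, Finset.mul_sum]
      refine Finset.sum_congr rfl fun i _ => ?_
      simp only [hg]
      ring
    rw [h1, abs_mul, abs_of_nonneg (pow_nonneg hρ.1.le _)]
    have h2 : ρ ^ (2 * K + D) = ρ ^ ((2 * K + D : ℝ) - M) * ρ ^ M := by
      rw [← Real.rpow_add hρ.1, sub_add_cancel, ← Real.rpow_natCast]
      push_cast
      rfl
    rw [h2]
    have h3 := mul_le_mul_of_nonneg_right (hP ρ hρ) (Real.rpow_nonneg hρ.1.le M)
    linarith)
  rw [Finset.sum_image hinj] at this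
  simp only [hback] at this
  exact this

/-- Lemma 5.5 of the paper. Let `d ≥ 2`, `d/2 < p < ∞`, and let
`V = q(|·|) ∈ L^p(B^d)` be radial real-valued, with Born approximation `W`. Then for every
`M > 0` such that `‖V‖_{L^p(B^d)} < (|S^{d-1}|^{1/p}/4)·((p-d/2)/(p-1))·M` one has
`∫_{B^d} |W(x)| |x|^{M-(d-2)} dx < M |S^{d-1}|`. -/
theorem statement17 (d : ℕ) (hd : 2 ≤ d) (p : ℝ) (hp : (d:ℝ) / 2 < p)
    (q : ℝ → ℝ) (hq : Measurable q)
    (W : Edim d → ℝ) (hW : IsBornApprox d q W)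
    (M : ℝ) (hM : 0 < M)
    (hVp : eLpNorm (fun x : Edim d => q ‖x‖) (ENNReal.ofReal p) (volume.restrict (unitBall d))
        < ENNReal.ofReal (sphereArea d ^ (1/p) / 4 * ((p - (d:ℝ)/2) / (p - 1)) * M)) :
    (∫⁻ x in unitBall d, ENNReal.ofReal (|W x| * ‖x‖ ^ (M - ((d:ℝ) - 2))))
      < ENNReal.ofReal (M * sphereArea d) := by
  obtain ⟨D, rfl⟩ : ∃ D, d = D + 2 := ⟨d - 2, by omega⟩
  have hD : (0:ℝ) ≤ D := Nat.cast_nonneg D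
  have hS := born_sphereArea_pos (D + 2) hd
  obtain ⟨hJ, hJle⟩ := born_Lp (D + 2) hd hp hq hM hVp
  have hcast : ((D + 2 : ℕ) : ℝ) = (D:ℝ) + 2 := by push_cast; rfl
  rw [hcast] at hJle hp
  obtain ⟨hI, hQ⟩ := born_holder hp hq hM hJ hJle
  obtain ⟨F, hF1, hF2⟩ := born_riccati hM hq hI hQ
  obtain ⟨hWm, ⟨w0, hw0⟩, lam, hlam, k₀, -, hfin, hmom⟩ := hW
  set S := sphereArea (D + 2) with hSdef
  set ν : Measure (Edim (D + 2)) := volume.restrict (unitBall (D + 2)) with hν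
  have hνf : IsFiniteMeasure ν := ⟨by
    rw [hν, Measure.restrict_apply_univ]
    exact measure_ball_lt_top⟩
  have hball : ∀ᵐ x ∂ν, ‖x‖ < 1 := by
    filter_upwards [ae_restrict_mem (show MeasurableSet (unitBall (D + 2)) from measurableSet_ball)]
      with x hx
    simpa [unitBall] using hx
  obtain ⟨k1, hk1⟩ := exists_nat_ge (M / 2 + 1)
  set K : ℕ := max k₀ k1 with hKdef
  have hK : M / 2 + 1 ≤ (K:ℝ) := hk1.trans (by exact_mod_cast le_max_right _ _)
  have hKk : k₀ ≤ K := le_max_left _ _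
  have hWI : ∀ k, k₀ ≤ k → Integrable (fun x => W x * ‖x‖ ^ (2 * k)) ν := by
    intro k hk
    have h0 : Integrable (fun x => W x * ‖x‖ ^ (2 * k₀)) ν := by
      refine ⟨(hWm.mul (measurable_norm.pow_const _)).aestronglyMeasurable, ?_⟩
      rw [hasFiniteIntegral_iff_norm]
      refine lt_of_le_of_lt (le_of_eq ?_) hfin
      refine lintegral_congr fun x => ?_
      rw [Real.norm_eq_abs, abs_mul, abs_of_nonneg (pow_nonneg (norm_nonneg x) _)]
    refine h0.mono (hWm.mul (measurable_norm.pow_const _)).aestronglyMeasurable ?_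
    filter_upwards [hball] with x hx
    rw [norm_mul, norm_mul, Real.norm_of_nonneg (pow_nonneg (norm_nonneg x) _),
      Real.norm_of_nonneg (pow_nonneg (norm_nonneg x) _)]
    exact mul_le_mul_of_nonneg_left
      (pow_le_pow_of_le_one (norm_nonneg x) hx.le (by omega)) (norm_nonneg _)
  have hmomF : ∀ k, K ≤ k → ∫ x, W x * ‖x‖ ^ (2 * k) ∂ν = S * F (2 * k + D) 1 := by
    intro k hk
    have h1 := hmom k (hKk.trans hk)
    have hk' : M / 2 + 1 ≤ (k:ℝ) := hK.trans (by exact_mod_cast hk)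
    rw [born_eig hM hq hI hF1 hF2 hk' (hlam k)] at h1
    rw [← h1, ← mul_assoc, mul_inv_cancel₀ hS.ne', one_mul]
  set e0 : Edim (D + 2) := EuclideanSpace.single 0 1 with he0
  have he0n : ‖e0‖ = 1 := by simp [he0]
  set w : ℝ → ℝ := fun r => W (r • e0) with hw
  have hwm : Measurable w := hWm.comp (measurable_id.smul_const e0)
  have hwW : ∀ x, w ‖x‖ = W x := by
    intro x
    simp only [hw]
    rw [hw0, hw0 x, norm_smul, he0n, mul_one, norm_norm]
  set μ : Measure ℝ := Measure.map (fun x : Edim (D + 2) => ‖x‖) ν with hμdef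
  have hμf : IsFiniteMeasure μ := Measure.isFiniteMeasure_map ν _
  have hnm : AEMeasurable (fun x : Edim (D + 2) => ‖x‖) ν := measurable_norm.aemeasurable
  have hμ : ∀ᵐ r ∂μ, r ∈ Ico (0:ℝ) 1 := by
    refine (ae_map_iff (p := fun r => r ∈ Ico (0:ℝ) 1) hnm measurableSet_Ico).2 ?_
    filter_upwards [hball] with x hx
    exact ⟨norm_nonneg x, hx⟩
  set e : ℝ := (2 * K + D : ℝ) - M with hedef
  have he : 0 ≤ e := by rw [hedef]; linarith
  have hwKm : Measurable (fun r => w r * r ^ (2 * K)) := hwm.mul (measurable_id.pow_const _)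
  have hint : Integrable (fun r => w r * r ^ (2 * K)) μ := by
    rw [hμdef, integrable_map_measure hwKm.aestronglyMeasurable hnm]
    refine (hWI K hKk).congr (Filter.Eventually.of_forall fun x => ?_)
    simp only [Function.comp_apply, hwW]
  have hyp : ∀ (P : Polynomial ℝ) (B : ℝ), (∀ ρ ∈ Ioc (0:ℝ) 1, |P.eval (ρ ^ 2)| * ρ ^ e ≤ B) →
      |∫ r, w r * r ^ (2 * K) * P.eval (r ^ 2) ∂μ| ≤ (S * (M / 2)) * B := by
    intro P B hPB
    have hPc : Continuous fun r : ℝ => P.eval (r ^ 2) := P.continuous.comp (continuous_pow 2)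
    have h1 : ∫ r, w r * r ^ (2 * K) * P.eval (r ^ 2) ∂μ
        = ∑ i ∈ Finset.range (P.natDegree + 1), P.coeff i * (S * F (2 * (K + i) + D) 1) := by
      have hmm : Measurable (fun r => w r * r ^ (2 * K) * P.eval (r ^ 2)) :=
        hwKm.mul hPc.measurable
      rw [hμdef, integral_map hnm hmm.aestronglyMeasurable]
      have h2 : ∀ x : Edim (D + 2), w ‖x‖ * ‖x‖ ^ (2 * K) * P.eval (‖x‖ ^ 2)
          = ∑ i ∈ Finset.range (P.natDegree + 1),
            P.coeff i * (W x * ‖x‖ ^ (2 * (K + i))) := by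
        intro x
        rw [hwW, Polynomial.eval_eq_sum_range, Finset.mul_sum]
        refine Finset.sum_congr rfl fun i _ => ?_
        ring
      simp only [h2]
      rw [integral_finsetSum _ fun i _ => (hWI (K + i) (by omega)).const_mul _]
      refine Finset.sum_congr rfl fun i _ => ?_
      rw [integral_const_mul, hmomF (K + i) (by omega)]
    have h3 := born_poly hM hK (hF1 1 (right_mem_Ioc.2 one_pos)) P B hPB
    have h4 : ∑ i ∈ Finset.range (P.natDegree + 1), P.coeff i * (S * F (2 * (K + i) + D) 1)
        = S * ∑ i ∈ Finset.range (P.natDegree + 1), P.coeff i * F (2 * (K + i) + D) 1 := by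
      rw [Finset.mul_sum]
      refine Finset.sum_congr rfl fun i _ => ?_
      ring
    rw [h1, h4, abs_mul, abs_of_pos hS, mul_assoc]
    exact mul_le_mul_of_nonneg_left h3 hS.le
  set f : ℕ → Edim (D + 2) → ℝ :=
    fun n x => |W x * ‖x‖ ^ (2 * K) / (max ‖x‖ (1 / ((n:ℝ) + 1))) ^ e| with hf
  have hfm : ∀ n, Measurable (f n) := by
    intro n
    exact ((hWm.mul (measurable_norm.pow_const _)).div
      ((measurable_norm.max measurable_const).pow_const _)).abs
  have hfle : ∀ n, ∫⁻ x, ENNReal.ofReal (f n x) ∂ν ≤ ENNReal.ofReal (S * (M / 2)) := by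
    intro n
    have hε : (0:ℝ) < 1 / ((n:ℝ) + 1) := by positivity
    obtain ⟨h1, h2⟩ := born_dual hμ he hint hyp hε
    have hm : Measurable (fun r => w r * r ^ (2 * K) / (max r (1 / ((n:ℝ) + 1))) ^ e) :=
      hwKm.div ((measurable_id.max measurable_const).pow_const _)
    rw [hμdef, integrable_map_measure hm.aestronglyMeasurable hnm] at h1
    rw [hμdef, integral_map hnm hm.abs.aestronglyMeasurable] at h2
    have h3 : ∀ x, |w ‖x‖ * ‖x‖ ^ (2 * K) / (max ‖x‖ (1 / ((n:ℝ) + 1))) ^ e| = f n x := by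
      intro x
      simp only [hf, hwW]
    simp only [h3] at h2
    have h4 : Integrable (f n) ν := by
      refine h1.abs.congr (Filter.Eventually.of_forall fun x => ?_)
      exact h3 x
    rw [← ofReal_integral_eq_lintegral_ofReal h4
      (Filter.Eventually.of_forall fun x => abs_nonneg _)]
    exact ENNReal.ofReal_le_ofReal h2
  have hne : ∀ᵐ x ∂ν, x ≠ 0 := by
    refine ae_restrict_of_ae ?_
    rw [ae_iff]
    simp
  have hlim : ∀ᵐ x ∂ν, ENNReal.ofReal (|W x| * ‖x‖ ^ (M - (((D + 2 : ℕ):ℝ) - 2)))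
      = Filter.liminf (fun n => ENNReal.ofReal (f n x)) Filter.atTop := by
    filter_upwards [hne] with x hx
    have hx0 : 0 < ‖x‖ := norm_pos_iff.2 hx
    symm
    apply Filter.Tendsto.liminf_eq
    refine tendsto_const_nhds.congr' ?_
    obtain ⟨n0, hn0⟩ := exists_nat_one_div_lt hx0
    filter_upwards [Filter.eventually_ge_atTop n0] with n hn
    have h1 : 1 / ((n:ℝ) + 1) ≤ ‖x‖ := (one_div_le_one_div_of_le (by positivity)
      (by have : (n0:ℝ) ≤ n := by exact_mod_cast hn
          linarith)).trans hn0.le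
    simp only [hf]
    rw [max_eq_left h1, abs_div, abs_mul, abs_of_nonneg (pow_nonneg hx0.le _),
      abs_of_nonneg (Real.rpow_nonneg hx0.le _), mul_div_assoc]
    congr 2
    rw [← Real.rpow_natCast, ← Real.rpow_sub hx0, hedef, hcast]
    congr 1
    push_cast
    ring
  calc ∫⁻ x, ENNReal.ofReal (|W x| * ‖x‖ ^ (M - (((D + 2 : ℕ):ℝ) - 2))) ∂ν
      = ∫⁻ x, Filter.liminf (fun n => ENNReal.ofReal (f n x)) Filter.atTop ∂ν :=
        lintegral_congr_ae hlim
    _ ≤ Filter.liminf (fun n => ∫⁻ x, ENNReal.ofReal (f n x) ∂ν) Filter.atTop :=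
        lintegral_liminf_le fun n => (hfm n).ennreal_ofReal
    _ ≤ Filter.liminf (fun _ : ℕ => ENNReal.ofReal (S * (M / 2))) Filter.atTop :=
        Filter.liminf_le_liminf (Filter.Eventually.of_forall hfle)
    _ = ENNReal.ofReal (S * (M / 2)) := Filter.liminf_const _
    _ < ENNReal.ofReal (M * S) := by
        have hMS : 0 < M * S := mul_pos hM hS
        rw [ENNReal.ofReal_lt_ofReal_iff hMS]
        linarith
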